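/- arXiv:1308.2729 — 12 statements merged into one kernel-verified Lean document; each statement's English description precedes it below -/
import Mathlib

section
/- Let X be a nonnegative integer-valued random variable with mean λ = E X ∈ (0,∞), and let X* have the size-biased distribution of X. If X* has the same distribution as X + 1, then X has the Poisson distribution with parameter λ. -/
open MeasureTheory

/-- The size-biased distribution of a law `μ` on `ℝ` (of a nonnegative random
variable with mean `a = ∫ y ∂μ ∈ (0,∞)`): the measure with density `x / a`
with respect to `μ`. -/
noncomputable def sizeBiasedLaw (μ : Measure ℝ) : Measure ℝ :=
  μ.withDensity fun x => ENNReal.ofReal (x / ∫ y, y ∂μ)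

/-- If `X` is a nonnegative integer-valued random variable with mean
`l = E X ∈ (0,∞)` and the size-biased version `X*` is distributed as `X + 1`,
then `X` is Poisson with parameter `l`. -/
theorem stmt0 {Ω : Type*} [MeasurableSpace Ω] (P : Measure Ω) [IsProbabilityMeasure P]
    (X : Ω → ℝ) (hX : Measurable X)
    (hint : ∀ ω, ∃ k : ℕ, X ω = k)
    (hInt : Integrable X P)
    (l : ℝ) (hl : l = ∫ ω, X ω ∂P) (hlpos : 0 < l)
    (hsb : sizeBiasedLaw (Measure.map X P) = Measure.map (fun ω => X ω + 1) P) :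
    ∀ k : ℕ, Measure.map X P {(k : ℝ)} =
      ENNReal.ofReal (Real.exp (-l) * l ^ k / (Nat.factorial k)) := by
  have hmean : ∫ y, y ∂(Measure.map X P) = l := by
    rw [integral_map hX.aemeasurable (by fun_prop), hl]
  -- the mass function and its recurrence
  set m : ℕ → ENNReal := fun k => Measure.map X P {(k : ℝ)} with hm
  have hmP : ∀ k, m k = P (X ⁻¹' {(k : ℝ)}) := fun k => by
    rw [hm]
    exact Measure.map_apply hX (measurableSet_singleton _)
  have hfin : ∀ k, m k ≠ ⊤ := fun k => by rw [hmP]; exact measure_ne_top _ _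
  have hrec : ∀ k : ℕ, ENNReal.ofReal (((k : ℝ) + 1) / l) * m (k + 1) = m k := by
    intro k
    have h := congrArg (fun ν : Measure ℝ => ν {((k + 1 : ℕ) : ℝ)}) hsb
    simp only [sizeBiasedLaw, hmean] at h
    rw [withDensity_apply _ (measurableSet_singleton _),
      Measure.map_apply (by fun_prop) (measurableSet_singleton _),
      lintegral_singleton] at h
    have hset : (fun ω => X ω + 1) ⁻¹' {((k + 1 : ℕ) : ℝ)} = X ⁻¹' {(k : ℝ)} := by
      ext ω
      simp
    rw [hset, ← hmP k] at h
    rw [← h]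
    push_cast
    simp [hm]
  have hrecR : ∀ k : ℕ, (m k).toReal = (m 0).toReal * (l ^ k / (Nat.factorial k)) := by
    intro k
    induction k with
    | zero => simp
    | succ k ih =>
      have h := congrArg ENNReal.toReal (hrec k)
      rw [ENNReal.toReal_mul, ENNReal.toReal_ofReal (by positivity), ih] at h
      have hk : (k : ℝ) + 1 ≠ 0 := by positivity
      have hf : (Nat.factorial k : ℝ) ≠ 0 := by positivity
      rw [Nat.factorial_succ]
      push_cast
      field_simp at h ⊢
      rw [pow_succ]
      linarith
  have hsum : ∑' k, m k = 1 := by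
    have hU : (⋃ k : ℕ, X ⁻¹' {(k : ℝ)}) = Set.univ := by
      ext ω
      simpa using hint ω
    have h := measure_iUnion (μ := P) (f := fun k : ℕ => X ⁻¹' {(k : ℝ)})
      (fun i j hij => by
        refine Disjoint.preimage _ ?_
        simpa using hij)
      (fun k => hX (measurableSet_singleton _))
    rw [hU, measure_univ] at h
    rw [h]
    exact tsum_congr hmP
  have hexp : HasSum (fun k : ℕ => l ^ k / (Nat.factorial k : ℝ)) (Real.exp l) := by
    rw [Real.exp_eq_exp_ℝ]
    exact NormedSpace.expSeries_div_hasSum_exp l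
  have h0 : (m 0).toReal * Real.exp l = 1 := by
    have h := congrArg ENNReal.toReal hsum
    rw [ENNReal.tsum_toReal_eq hfin, tsum_congr hrecR, (hexp.mul_left _).tsum_eq] at h
    simpa using h
  intro k
  have h0' : (m 0).toReal = Real.exp (-l) := by
    rw [Real.exp_neg]
    exact eq_inv_of_mul_eq_one_left h0
  change m k = _
  rw [← ENNReal.ofReal_toReal (hfin k), hrecR, h0', mul_div_assoc]
end

section
/- Suppose X, X_1, X_2, … are nonnegative random variables with a := E X ∈ (0,∞) and a_n := E X_n ∈ (0,∞) for all n, that X_n converges to X in distribution, and that a_n → a. Then X_n* converges in distribution to X*, where X_n* and X* have the size-biased distributions of X_n and X respectively. -/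
open MeasureTheory Filter Topology

/-- Expectation under the size-biased law. -/
lemma integral_sizeBiasedLaw_map {Ω : Type*} [MeasurableSpace Ω] (P : Measure Ω)
    (Y : Ω → ℝ) (hm : Measurable Y) (hnn : ∀ ω, 0 ≤ Y ω) (hpos : 0 < ∫ ω, Y ω ∂P)
    (f : BoundedContinuousFunction ℝ ℝ) :
    ∫ x, f x ∂(sizeBiasedLaw (Measure.map Y P)) = (∫ ω, Y ω * f (Y ω) ∂P) / ∫ ω, Y ω ∂P := by
  have hmean : ∫ y, y ∂(Measure.map Y P) = ∫ ω, Y ω ∂P :=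
    integral_map hm.aemeasurable (f := fun y : ℝ => y) (by fun_prop)
  have hfm : Measurable f := f.continuous.measurable
  unfold sizeBiasedLaw
  rw [hmean, integral_withDensity_eq_integral_toReal_smul (by fun_prop) (by simp),
    integral_map hm.aemeasurable (by
      apply Measurable.aestronglyMeasurable
      fun_prop), ← integral_div]
  congr 1
  ext ω
  rw [ENNReal.toReal_ofReal (div_nonneg (hnn ω) hpos.le), smul_eq_mul]
  ring

/-- Truncation to `[0, K]`, as a bounded continuous function. -/
noncomputable def truncBCF (K : ℕ) : BoundedContinuousFunction ℝ ℝ :=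
  BoundedContinuousFunction.ofNormedAddCommGroup (fun x => max 0 (min x (K : ℝ)))
    (by fun_prop) K (by
      intro x
      rw [Real.norm_eq_abs, abs_of_nonneg (le_max_left _ _)]
      exact max_le (Nat.cast_nonneg K) (min_le_right _ _))

lemma truncBCF_apply (K : ℕ) (x : ℝ) : truncBCF K x = max 0 (min x (K : ℝ)) := rfl

lemma integrable_bcf_comp {Ω : Type*} [MeasurableSpace Ω] (P : Measure Ω) [IsProbabilityMeasure P]
    (Y : Ω → ℝ) (hm : Measurable Y) (g : BoundedContinuousFunction ℝ ℝ) :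
    Integrable (fun ω => g (Y ω)) P :=
  Integrable.of_bound ((g.continuous.measurable.comp hm).aestronglyMeasurable) ‖g‖
    (Eventually.of_forall fun ω => g.norm_coe_le_norm _)

/-- Truncation error bound. -/
lemma trunc_error {Ω : Type*} [MeasurableSpace Ω] (P : Measure Ω) [IsProbabilityMeasure P]
    (Y : Ω → ℝ) (hm : Measurable Y) (hnn : ∀ ω, 0 ≤ Y ω) (hI : Integrable Y P)
    (f : BoundedContinuousFunction ℝ ℝ) (K : ℕ) :
    |∫ ω, Y ω * f (Y ω) ∂P - ∫ ω, (truncBCF K * f) (Y ω) ∂P|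
      ≤ ‖f‖ * (∫ ω, Y ω ∂P - ∫ ω, truncBCF K (Y ω) ∂P) := by
  have h1 : Integrable (fun ω => Y ω * f (Y ω)) P :=
    hI.mul_bdd (c := ‖f‖) ((f.continuous.measurable.comp hm).aestronglyMeasurable)
      (Eventually.of_forall fun ω => f.norm_coe_le_norm _)
  have h2 := integrable_bcf_comp P Y hm (truncBCF K * f)
  have h3 := integrable_bcf_comp P Y hm (truncBCF K)
  rw [← integral_sub h1 h2, ← integral_sub hI h3, ← integral_const_mul, ← Real.norm_eq_abs]
  refine norm_integral_le_of_norm_le ((hI.sub h3).const_mul _) (Eventually.of_forall fun ω => ?_)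
  have h4 : truncBCF K (Y ω) ≤ Y ω := by
    rw [truncBCF_apply]
    exact max_le (hnn ω) (min_le_left _ _)
  have h5 := f.norm_coe_le_norm (Y ω)
  rw [BoundedContinuousFunction.mul_apply, ← sub_mul, norm_mul, Real.norm_eq_abs (_ - _),
    abs_of_nonneg (sub_nonneg.2 h4), mul_comm]
  exact mul_le_mul_of_nonneg_right h5 (sub_nonneg.2 h4)

lemma tendsto_trunc {Ω : Type*} [MeasurableSpace Ω] (P : Measure Ω) [IsProbabilityMeasure P]
    (Y : Ω → ℝ) (hm : Measurable Y) (hnn : ∀ ω, 0 ≤ Y ω) (hI : Integrable Y P) :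
    Tendsto (fun K : ℕ => ∫ ω, truncBCF K (Y ω) ∂P) atTop (𝓝 (∫ ω, Y ω ∂P)) := by
  refine tendsto_integral_of_dominated_convergence Y
    (fun K => (integrable_bcf_comp P Y hm (truncBCF K)).1) hI
    (fun K => Eventually.of_forall fun ω => ?_) (Eventually.of_forall fun ω => ?_)
  · rw [truncBCF_apply, Real.norm_eq_abs, abs_of_nonneg (le_max_left _ _)]
    exact max_le (hnn ω) (min_le_left _ _)
  · obtain ⟨N, hN⟩ := exists_nat_ge (Y ω)
    refine tendsto_const_nhds.congr' ?_
    filter_upwards [eventually_ge_atTop N] with K hK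
    have : Y ω ≤ K := hN.trans (by exact_mod_cast hK)
    rw [truncBCF_apply, min_eq_left this, max_eq_right (hnn ω)]

/-- Suppose `X, X₁, X₂, …` are nonnegative random variables with means
`a := E X ∈ (0,∞)` and `aₙ := E Xₙ ∈ (0,∞)`, that `Xₙ ⇒ X` in distribution
(i.e. `E f(Xₙ) → E f(X)` for every bounded continuous `f`), and `aₙ → a`.
Then `Xₙ* ⇒ X*`, where `Xₙ*`, `X*` have the size-biased distributions. -/
theorem stmt4 {Ω : Type*} [MeasurableSpace Ω] (P : Measure Ω) [IsProbabilityMeasure P]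
    (X : ℕ → Ω → ℝ) (X₀ : Ω → ℝ)
    (hmeas : ∀ n, Measurable (X n)) (hmeas0 : Measurable X₀)
    (hnonneg : ∀ n ω, 0 ≤ X n ω) (hnn0 : ∀ ω, 0 ≤ X₀ ω)
    (hInt : ∀ n, Integrable (X n) P) (hInt0 : Integrable X₀ P)
    (hpos : ∀ n, 0 < ∫ ω, X n ω ∂P) (hpos0 : 0 < ∫ ω, X₀ ω ∂P)
    (hconv : ∀ f : BoundedContinuousFunction ℝ ℝ,
      Tendsto (fun n => ∫ ω, f (X n ω) ∂P) atTop (𝓝 (∫ ω, f (X₀ ω) ∂P)))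
    (hmean : Tendsto (fun n => ∫ ω, X n ω ∂P) atTop (𝓝 (∫ ω, X₀ ω ∂P))) :
    ∀ f : BoundedContinuousFunction ℝ ℝ,
      Tendsto (fun n => ∫ x, f x ∂(sizeBiasedLaw (Measure.map (X n) P))) atTop
        (𝓝 (∫ x, f x ∂(sizeBiasedLaw (Measure.map X₀ P)))) := by
  intro f
  simp_rw [fun n => integral_sizeBiasedLaw_map P (X n) (hmeas n) (hnonneg n) (hpos n) f]
  rw [integral_sizeBiasedLaw_map P X₀ hmeas0 hnn0 hpos0 f]
  refine Tendsto.div ?_ hmean hpos0.ne'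
  rw [Metric.tendsto_atTop']
  refine fun ε hε => ?_
  have hK : Tendsto (fun K : ℕ => ‖f‖ * (∫ ω, X₀ ω ∂P - ∫ ω, truncBCF K (X₀ ω) ∂P)) atTop
      (𝓝 0) := by
    have := ((tendsto_const_nhds (x := ∫ ω, X₀ ω ∂P)).sub
      (tendsto_trunc P X₀ hmeas0 hnn0 hInt0)).const_mul ‖f‖
    simpa using this
  obtain ⟨K, hK⟩ := (hK.eventually_lt_const (show (0 : ℝ) < ε / 3 by positivity)).exists
  have e1 := ((hmean.sub (hconv (truncBCF K))).const_mul ‖f‖).eventually_lt_const hK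
  have e2 := (hconv (truncBCF K * f)).eventually
    (Metric.ball_mem_nhds _ (show (0 : ℝ) < ε / 3 by positivity))
  obtain ⟨N, hN⟩ := eventually_atTop.1 (e1.and e2)
  refine ⟨N, fun n hn => ?_⟩
  obtain ⟨h1, h2⟩ := hN n hn.le
  rw [Real.dist_eq] at h2
  rw [Real.dist_eq]
  have h3 := trunc_error P (X n) (hmeas n) (hnonneg n) (hInt n) f K
  have h4 := trunc_error P X₀ hmeas0 hnn0 hInt0 f K
  rw [abs_le] at h3 h4
  rw [abs_lt] at h2 ⊢
  constructor <;> linarith [h3.1, h3.2, h4.1, h4.2, h2.1, h2.2]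
end

section
/- Let I ⊂ ℝ, let h be a probability measure on I, and for each b ∈ I let μ_b be the distribution of a nonnegative random variable X_b with mean m(b) := E X_b ∈ (0,∞), with b ↦ μ_b measurable. Let the distribution of X be the mixture of the μ_b governed by h, i.e., E g(X) = ∫ E g(X_b) dh(b) for all bounded measurable g, and assume a := ∫ m(b) dh(b) ∈ (0,∞). Then the distribution of X* is the mixture of the distributions of X_b* governed by the probability measure h' defined by the Radon–Nikodym derivative dh'(b)/dh(b) = m(b)/a. In particular, if m(b) is constant in b, then h' = h. -/
open MeasureTheory ProbabilityTheory

/-- Size-biasing a mixture.  Let `h` be a probability measure carried by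
`I ⊆ ℝ`, and for each `b` let `κ b` be the distribution of a nonnegative
random variable with mean `m b = ∫ x ∂(κ b) ∈ (0,∞)` (the measurability of
`b ↦ κ b` is packaged in the kernel `κ`).  Let the law of `X` be the mixture
`h.bind κ`, and assume `a := ∫ m dh ∈ (0,∞)`.  Then the size-biased law of
`X` is the mixture of the size-biased laws `(κ b)*` governed by the measure
`h'` with `dh'/dh = m b / a`; and if `m` is constant on `I`, then `h' = h`. -/
theorem stmt5 (I : Set ℝ) (hI : MeasurableSet I)
    (h : Measure ℝ) [IsProbabilityMeasure h] (hsupp : h Iᶜ = 0)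
    (κ : Kernel ℝ ℝ) [IsMarkovKernel κ]
    (hnonneg : ∀ b ∈ I, (κ b) {x | x < 0} = 0)
    (hIntb : ∀ b ∈ I, Integrable (fun x => x) (κ b))
    (m : ℝ → ℝ) (hm : ∀ b, m b = ∫ x, x ∂(κ b))
    (hmpos : ∀ b ∈ I, 0 < m b)
    (hmInt : Integrable m h)
    (a : ℝ) (ha : a = ∫ b, m b ∂h) (hapos : 0 < a) :
    sizeBiasedLaw (h.bind fun b => κ b) =
      (h.withDensity fun b => ENNReal.ofReal (m b / a)).bind
        (fun b => sizeBiasedLaw (κ b)) ∧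
    ((∀ b ∈ I, ∀ b' ∈ I, m b = m b') →
      (h.withDensity fun b => ENNReal.ofReal (m b / a)) = h) := by
  have hmm : Measurable m := by
    have : m = fun b => ∫ x, x ∂(κ b) := funext hm
    rw [this]
    exact (StronglyMeasurable.integral_kernel (κ := κ)
      (f := fun x : ℝ => x) measurable_id.stronglyMeasurable).measurable
  have hae : ∀ᵐ b ∂h, b ∈ I := by
    rw [ae_iff]; exact hsupp
  have hκ : AEMeasurable (fun b => κ b) h := κ.measurable.aemeasurable
  have hnn : ∀ b ∈ I, ∀ᵐ x ∂(κ b), 0 ≤ x := by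
    intro b hb
    rw [ae_iff]
    simpa using hnonneg b hb
  have hd : Measurable fun b => ENNReal.ofReal (m b / a) :=
    (hmm.div_const a).ennreal_ofReal
  have hmean : ∫ y, y ∂(h.bind fun b => κ b) = a := by
    have h1 : ∀ᵐ y ∂(h.bind fun b => κ b), 0 ≤ y := by
      have hms : MeasurableSet {y : ℝ | ¬ 0 ≤ y} := measurableSet_Ici.compl
      rw [ae_iff, Measure.bind_apply hms hκ]
      rw [lintegral_eq_zero_iff' ]
      · filter_upwards [hae] with b hb
        simpa using hnonneg b hb
      · exact (κ.measurable_coe hms).aemeasurable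
    rw [integral_eq_lintegral_of_nonneg_ae h1 measurable_id.aestronglyMeasurable,
      Measure.lintegral_bind hκ ENNReal.measurable_ofReal.aemeasurable]
    have h2 : ∫⁻ b, ∫⁻ x, ENNReal.ofReal x ∂(κ b) ∂h = ∫⁻ b, ENNReal.ofReal (m b) ∂h := by
      apply lintegral_congr_ae
      filter_upwards [hae] with b hb
      rw [hm b, ofReal_integral_eq_lintegral_ofReal (hIntb b hb) (hnn b hb)]
    rw [h2, ← ofReal_integral_eq_lintegral_ofReal hmInt, ← ha, ENNReal.toReal_ofReal hapos.le]
    filter_upwards [hae] with b hb using (hmpos b hb).le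
  have hjoint : Measurable (Function.uncurry fun b x : ℝ => ENNReal.ofReal (x / m b)) :=
    (measurable_snd.div (hmm.comp measurable_fst)).ennreal_ofReal
  have hker : (fun b => sizeBiasedLaw (κ b)) =
      fun b => (Kernel.withDensity κ (fun b x : ℝ => ENNReal.ofReal (x / m b))) b := by
    funext b
    rw [Kernel.withDensity_apply _ hjoint, sizeBiasedLaw, hm b]
  have hda : Measurable fun x : ℝ => ENNReal.ofReal (x / a) :=
    (measurable_id.div_const a).ennreal_ofReal
  have hdb : ∀ b, Measurable fun x : ℝ => ENNReal.ofReal (x / m b) := fun b =>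
    (measurable_id.div_const (m b)).ennreal_ofReal
  constructor
  · rw [hker]
    ext s hs
    rw [Measure.bind_apply hs (Kernel.measurable _).aemeasurable,
      lintegral_withDensity_eq_lintegral_mul _ hd (Kernel.measurable_coe _ hs),
      sizeBiasedLaw, hmean, withDensity_apply _ hs, ← lintegral_indicator hs,
      Measure.lintegral_bind hκ
        (hda.indicator hs).aemeasurable]
    apply lintegral_congr_ae
    filter_upwards [hae] with b hb
    rw [Pi.mul_apply, Kernel.withDensity_apply' _ hjoint, lintegral_indicator hs,
      ← lintegral_const_mul _ (hdb b)]
    refine lintegral_congr fun x => ?_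
    have := hmpos b hb
    rw [← ENNReal.ofReal_mul (by positivity)]
    congr 1
    field_simp
  · intro hc
    have : (fun b => ENNReal.ofReal (m b / a)) =ᵐ[h] 1 := by
      filter_upwards [hae] with b hb
      have : a = m b := by
        rw [ha, integral_congr_ae (g := fun _ => m b)]
        · simp
        · filter_upwards [hae] with b' hb' using hc b' hb' b hb
      rw [← this, div_self hapos.ne']
      simp
    rw [withDensity_congr_ae this, withDensity_one]
end

section
/- A random variable Z satisfies Z =^d X* for some nonnegative random variable X with mean in (0,∞) if and only if P(Z > 0) = 1 and E(1/Z) < ∞. Moreover, in that case there is a unique law for a strictly positive random variable Y such that every X with X* =^d Z has distribution b·δ_0 + (1−b)·L(Y) for some b ∈ [0,1), where δ_0 is the point mass at 0. -/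
open MeasureTheory

/-- The candidate law of `Y`: density proportional to `1/x` with respect to `ζ`. -/
noncomputable def nuLaw (ζ : Measure ℝ) : Measure ℝ :=
  (∫⁻ x, ENNReal.ofReal (1 / x) ∂ζ)⁻¹ • ζ.withDensity fun x => ENNReal.ofReal (1 / x)

lemma neg_null (ν : Measure ℝ) (h : ν {x | x ≤ 0} = 0) : ν {x | x < 0} = 0 := by
  refine measure_mono_null ?_ h
  intro x hx
  have hx' : x < 0 := hx
  exact hx'.le

lemma meas_inv : Measurable fun x : ℝ => ENNReal.ofReal (1 / x) := by fun_prop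

/-- Inverting the size bias. -/
lemma key_inv (μ : Measure ℝ) (h : 0 < ∫ x, x ∂μ) :
    (sizeBiasedLaw μ).withDensity (fun x => ENNReal.ofReal (1 / x)) =
      ENNReal.ofReal (1 / ∫ x, x ∂μ) • μ.restrict (Set.Ioi 0) := by
  unfold sizeBiasedLaw
  rw [← withDensity_mul _ (by fun_prop) meas_inv, ← withDensity_const,
    ← withDensity_indicator measurableSet_Ioi]
  congr 1
  funext x
  by_cases hx : 0 < x
  · simp only [Pi.mul_apply, Set.indicator, Set.mem_Ioi, hx, if_true]
    rw [← ENNReal.ofReal_mul (by positivity)]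
    congr 1
    field_simp
  · have h2 : 1 / x ≤ 0 := one_div_nonpos.2 (not_lt.1 hx)
    simp [Set.indicator, hx, not_lt.1 hx]

lemma inv_bounds (ζ : Measure ℝ) [IsProbabilityMeasure ζ] (h0 : ζ {x | x ≤ 0} = 0) :
    (∫⁻ x, ENNReal.ofReal (1 / x) ∂ζ) ≠ 0 := by
  intro h
  rw [lintegral_eq_zero_iff meas_inv] at h
  have h1 : ∀ᵐ x ∂ζ, ¬ x ≤ 0 := by rw [ae_iff]; simpa using h0
  have : ∀ᵐ x ∂ζ, False := by
    filter_upwards [h, h1] with x hx hx'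
    have : 1 / x ≤ 0 := by simpa using hx
    have h3 : 0 < 1 / x := by have := not_le.1 hx'; positivity
    linarith
  have h5 := this.exists
  simp at h5

lemma nu_props (ζ : Measure ℝ) [IsProbabilityMeasure ζ] (h0 : ζ {x | x ≤ 0} = 0)
    (hm : (∫⁻ x, ENNReal.ofReal (1 / x) ∂ζ) < ⊤) :
    IsProbabilityMeasure (nuLaw ζ) ∧ nuLaw ζ {x | x ≤ 0} = 0 ∧
      Integrable (fun x => x) (nuLaw ζ) ∧ 0 < (∫ x, x ∂(nuLaw ζ)) ∧
      sizeBiasedLaw (nuLaw ζ) = ζ := by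
  have hm0 := inv_bounds ζ h0
  have h1 : ∀ᵐ x ∂ζ, 0 < x := by rw [ae_iff]; simpa using h0
  set m := ∫⁻ x, ENNReal.ofReal (1 / x) ∂ζ with hmdef
  have hnu : nuLaw ζ = m⁻¹ • ζ.withDensity fun x => ENNReal.ofReal (1 / x) := rfl
  have hac : nuLaw ζ ≪ ζ := by
    rw [hnu]
    exact (withDensity_absolutelyContinuous _ _).smul_left _
  have hpos : ∀ᵐ x ∂(nuLaw ζ), 0 < x := hac.ae_le h1
  have hprod : (fun x : ℝ => ENNReal.ofReal (1 / x) * ENNReal.ofReal x) =ᵐ[ζ] fun _ => 1 := by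
    filter_upwards [h1] with x hx
    rw [← ENNReal.ofReal_mul (by positivity), one_div_mul_cancel hx.ne', ENNReal.ofReal_one]
  have hmean : ∫⁻ x, ENNReal.ofReal x ∂(nuLaw ζ) = m⁻¹ := by
    rw [hnu, lintegral_smul_measure,
      lintegral_withDensity_eq_lintegral_mul _ meas_inv ENNReal.measurable_ofReal]
    have : ∫⁻ x, ((fun x : ℝ => ENNReal.ofReal (1 / x)) * fun x => ENNReal.ofReal x) x ∂ζ = 1 := by
      refine (lintegral_congr_ae (g := fun _ => 1) hprod).trans ?_
      simp
    rw [this]; simp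
  have hint : ∫ x, x ∂(nuLaw ζ) = m⁻¹.toReal := by
    rw [integral_eq_lintegral_of_nonneg_ae (hpos.mono fun x hx => hx.le)
      (by fun_prop), hmean]
  have hmi0 : m⁻¹ ≠ 0 := ENNReal.inv_ne_zero.2 hm.ne
  have hmit : m⁻¹ ≠ ⊤ := ENNReal.inv_ne_top.2 hm0
  have hp : 0 < m⁻¹.toReal := ENNReal.toReal_pos hmi0 hmit
  refine ⟨⟨?_⟩, hac h0, ⟨by fun_prop, ?_⟩, hint ▸ hp, ?_⟩
  · rw [hnu, Measure.smul_apply, withDensity_apply _ MeasurableSet.univ, Measure.restrict_univ]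
    exact ENNReal.inv_mul_cancel hm0 hm.ne
  · rw [hasFiniteIntegral_iff_ofReal (hpos.mono fun x hx => hx.le), hmean]
    exact hmit.lt_top
  · unfold sizeBiasedLaw
    rw [hint, hnu, withDensity_smul_measure,
      ← withDensity_mul _ meas_inv (by fun_prop), ← withDensity_smul _ (by fun_prop)]
    have : (m⁻¹ • ((fun x : ℝ => ENNReal.ofReal (1 / x)) *
        fun x => ENNReal.ofReal (x / m⁻¹.toReal))) =ᵐ[ζ] 1 := by
      filter_upwards [hprod] with x hx
      simp only [Pi.smul_apply, Pi.mul_apply, smul_eq_mul, Pi.one_apply]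
      rw [ENNReal.ofReal_div_of_pos hp, ENNReal.ofReal_toReal hmit,
        div_eq_mul_inv (ENNReal.ofReal x),
        ← mul_assoc (ENNReal.ofReal _), hx, one_mul]
      exact ENNReal.mul_inv_cancel hmi0 hmit
    rw [withDensity_congr_ae this, withDensity_one]

lemma forward (ζ μ : Measure ℝ) [IsProbabilityMeasure ζ] [IsProbabilityMeasure μ]
    (hμ : μ {x | x < 0} = 0) (ha : 0 < ∫ x, x ∂μ) (hs : sizeBiasedLaw μ = ζ) :
    ζ {x | x ≤ 0} = 0 ∧ (∫⁻ x, ENNReal.ofReal (1 / x) ∂ζ) < ⊤ ∧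
      ∃ p : ℝ, 0 ≤ p ∧ p < 1 ∧
            μ = ENNReal.ofReal p • Measure.dirac (0 : ℝ) +
              ENNReal.ofReal (1 - p) • nuLaw ζ := by
  have hk := key_inv μ ha
  rw [hs] at hk
  have h0 : ζ {x | x ≤ 0} = 0 := by
    change ζ (Set.Iic 0) = 0
    rw [← hs, sizeBiasedLaw, withDensity_apply _ measurableSet_Iic]
    refine (setLIntegral_congr_fun (g := fun _ => 0) measurableSet_Iic fun x hx => ?_).trans
      (by simp)
    exact ENNReal.ofReal_of_nonpos (div_nonpos_of_nonpos_of_nonneg hx ha.le)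
  have hm : (∫⁻ x, ENNReal.ofReal (1 / x) ∂ζ) =
      ENNReal.ofReal (1 / ∫ x, x ∂μ) * μ (Set.Ioi 0) := by
    have := congrArg (fun κ => κ Set.univ) hk
    simpa [withDensity_apply _ MeasurableSet.univ] using this
  have hm0 := inv_bounds ζ h0
  have hmt : (∫⁻ x, ENNReal.ofReal (1 / x) ∂ζ) < ⊤ := by
    rw [hm]; exact ENNReal.mul_lt_top ENNReal.ofReal_lt_top (measure_lt_top _ _)
  refine ⟨h0, hmt, ?_⟩
  have hI0 : μ (Set.Ioi 0) ≠ 0 := by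
    intro h; rw [hm, h] at hm0; simp at hm0
  have hnu : μ (Set.Ioi 0) • nuLaw ζ = μ.restrict (Set.Ioi 0) := by
    rw [nuLaw, hk, hm, smul_smul, smul_smul]
    have hc0 : ENNReal.ofReal (1 / ∫ x, x ∂μ) ≠ 0 := by
      rw [Ne, ENNReal.ofReal_eq_zero, not_le]; positivity
    rw [ENNReal.mul_inv (Or.inl hc0) (Or.inl ENNReal.ofReal_ne_top)]
    rw [show μ (Set.Ioi 0) * ((ENNReal.ofReal (1 / ∫ x, x ∂μ))⁻¹ * (μ (Set.Ioi 0))⁻¹) *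
      ENNReal.ofReal (1 / ∫ x, x ∂μ) = (μ (Set.Ioi 0) * (μ (Set.Ioi 0))⁻¹) *
        (ENNReal.ofReal (1 / ∫ x, x ∂μ) * (ENNReal.ofReal (1 / ∫ x, x ∂μ))⁻¹) by ring,
      ENNReal.mul_inv_cancel hI0 (measure_ne_top _ _),
      ENNReal.mul_inv_cancel hc0 ENNReal.ofReal_ne_top, one_mul, one_smul]
  have hIio : Set.Iic (0:ℝ) =ᵐ[μ] ({0} : Set ℝ) := by
    have hnn : ∀ᵐ x ∂μ, ¬ x < 0 := by rw [ae_iff]; simpa using hμ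
    filter_upwards [hnn] with x hx
    apply propext
    change x ≤ 0 ↔ x = 0
    constructor
    · intro h; exact le_antisymm h (not_lt.1 hx)
    · intro h; exact h.le
  have hc : μ {0} = 1 - μ (Set.Ioi 0) := by
    rw [← measure_congr hIio, ← Set.compl_Ioi, prob_compl_eq_one_sub measurableSet_Ioi]
  have e1 : 1 - (1 - μ.real (Set.Ioi 0)) = μ.real (Set.Ioi 0) := by ring
  refine ⟨1 - μ.real (Set.Ioi 0), sub_nonneg.2 measureReal_le_one, ?_, ?_⟩
  · have : 0 < μ.real (Set.Ioi 0) := ENNReal.toReal_pos hI0 (measure_ne_top _ _)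
    linarith
  · rw [e1, ENNReal.ofReal_sub _ measureReal_nonneg, ofReal_measureReal, ENNReal.ofReal_one,
      ← hc, hnu, ← Measure.restrict_singleton, ← Measure.restrict_congr_set hIio,
      add_comm, ← Set.compl_Ioi, Measure.restrict_add_restrict_compl measurableSet_Ioi]

/-- A law `ζ` is the size-biased law of some nonnegative `X` with mean in
`(0,∞)` iff `P(Z > 0) = 1` and `E (1/Z) < ∞`; and in that case there is a
unique law `ν` of a strictly positive random variable `Y` such that every
such `X` has law `p·δ₀ + (1-p)·ν` for some `p ∈ [0,1)`. -/
theorem stmt7 (ζ : Measure ℝ) [IsProbabilityMeasure ζ] :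
    ((∃ μ : Measure ℝ, IsProbabilityMeasure μ ∧ μ {x | x < 0} = 0 ∧
        Integrable (fun x => x) μ ∧ 0 < (∫ x, x ∂μ) ∧ sizeBiasedLaw μ = ζ) ↔
      (ζ {x | x ≤ 0} = 0 ∧ (∫⁻ x, ENNReal.ofReal (1 / x) ∂ζ) < ⊤)) ∧
    ((∃ μ : Measure ℝ, IsProbabilityMeasure μ ∧ μ {x | x < 0} = 0 ∧
        Integrable (fun x => x) μ ∧ 0 < (∫ x, x ∂μ) ∧ sizeBiasedLaw μ = ζ) →
      ∃! ν : Measure ℝ, IsProbabilityMeasure ν ∧ ν {x | x ≤ 0} = 0 ∧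
        ∀ μ : Measure ℝ, IsProbabilityMeasure μ → μ {x | x < 0} = 0 →
          Integrable (fun x => x) μ → 0 < (∫ x, x ∂μ) → sizeBiasedLaw μ = ζ →
          ∃ p : ℝ, 0 ≤ p ∧ p < 1 ∧
            μ = ENNReal.ofReal p • Measure.dirac (0 : ℝ) +
              ENNReal.ofReal (1 - p) • ν) := by
  refine ⟨⟨?_, ?_⟩, ?_⟩
  · rintro ⟨μ, h1, h2, -, h4, h5⟩
    have := forward ζ μ h2 h4 h5
    exact ⟨this.1, this.2.1⟩
  · rintro ⟨h0, hm⟩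
    obtain ⟨a, b, c, d, e⟩ := nu_props ζ h0 hm
    exact ⟨nuLaw ζ, a, neg_null _ b, c, d, e⟩
  · rintro ⟨μ, h1, h2, -, h4, h5⟩
    obtain ⟨h0, hm, -⟩ := forward ζ μ h2 h4 h5
    obtain ⟨a, b, c, d, e⟩ := nu_props ζ h0 hm
    refine ⟨nuLaw ζ, ⟨a, b, ?_⟩, ?_⟩
    · intro μ' i1 i2 _ i4 i5
      exact (forward ζ μ' i2 i4 i5).2.2
    · rintro ν' ⟨a', b', hν'⟩
      obtain ⟨p, p0, p1, hp⟩ := hν' (nuLaw ζ) a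
        (neg_null _ b) c d e
      have h := congrArg (fun κ => κ {x : ℝ | x ≤ 0}) hp
      have hd : Measure.dirac (0 : ℝ) {x : ℝ | x ≤ 0} = 1 :=
by
        apply Measure.dirac_apply_of_mem
        simp
      simp only [b, Measure.add_apply, Measure.smul_apply, hd, b', smul_eq_mul, mul_one,
        mul_zero, add_zero] at h
      have : p = 0 := le_antisymm (ENNReal.ofReal_eq_zero.1 h.symm) p0
      rw [hp, this]
      simp
end

section
/- Let X be a nonnegative integer-valued random variable with λ := E X ∈ (0,∞), and let Z be Poisson with parameter λ. Then for any coupling of X with X* (any joint distribution whose marginals are the distribution of X and the size-biased distribution of X), the total variation distance between the distributions of X and Z satisfies d_TV(X, Z) ≤ (1 − e^{−λ}) E|X* − (X + 1)|. -/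
open MeasureTheory

noncomputable def poisP (l : ℝ) (k : ℕ) : ℝ := Real.exp (-l) * l ^ k / (Nat.factorial k)

lemma poisP_pos {l : ℝ} (hl : 0 < l) (k : ℕ) : 0 < poisP l k := by
  unfold poisP; positivity

lemma poisP_succ (l : ℝ) (k : ℕ) : poisP l (k+1) * ((k:ℝ)+1) = l * poisP l k := by
  unfold poisP
  rw [Nat.factorial_succ]
  have : (Nat.factorial k : ℝ) ≠ 0 := by positivity
  push_cast
  field_simp
  ring

lemma poisP_hasSum {l : ℝ} (hl : 0 < l) : HasSum (poisP l) 1 :=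
  ProbabilityTheory.hasSum_one_poissonMeasure (⟨l, hl.le⟩ : NNReal)

noncomputable def steinF (l : ℝ) (k : ℕ) : ℝ := ∑ i ∈ Finset.range (k+1), poisP l i
noncomputable def steinA (l : ℝ) (s : ℕ → ℝ) (k : ℕ) : ℝ :=
  ∑ i ∈ Finset.range (k+1), s i * poisP l i
noncomputable def steinPi (l : ℝ) (s : ℕ → ℝ) : ℝ := ∑' i, s i * poisP l i
noncomputable def steinG (l : ℝ) (s : ℕ → ℝ) (k : ℕ) : ℝ :=
  (steinA l s k - steinPi l s * steinF l k) / (l * poisP l k)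

lemma poisP_cross {l : ℝ} (hl : 0 < l) {i k : ℕ} (h : i ≤ k) :
    poisP l i * poisP l (k+1) ≤ poisP l (i+1) * poisP l k := by
  have h1 := poisP_succ l i
  have h2 := poisP_succ l k
  have hi := poisP_pos hl i
  have hk := poisP_pos hl k
  have hik : (i:ℝ) ≤ k := by exact_mod_cast h
  have e1 : poisP l (i+1) = l * poisP l i / ((i:ℝ)+1) := by
    rw [← h1]; field_simp
  have e2 : poisP l (k+1) = l * poisP l k / ((k:ℝ)+1) := by
    rw [← h2]; field_simp
  rw [e1, e2]
  have : poisP l i * (l * poisP l k / ((k:ℝ)+1)) = (l * poisP l i * poisP l k) / ((k:ℝ)+1) := by ring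
  rw [this]
  have : l * poisP l i / ((i:ℝ)+1) * poisP l k = (l * poisP l i * poisP l k) / ((i:ℝ)+1) := by ring
  rw [this]
  gcongr

lemma stein_summable {l : ℝ} (hl : 0 < l) {s : ℕ → ℝ} (h0 : ∀ i, 0 ≤ s i) (h1 : ∀ i, s i ≤ 1) :
    Summable fun i => s i * poisP l i :=
  Summable.of_nonneg_of_le (fun i => mul_nonneg (h0 i) (poisP_pos hl i).le)
    (fun i => mul_le_of_le_one_left (poisP_pos hl i).le (h1 i)) (poisP_hasSum hl).summable

lemma stein_tail {l : ℝ} (hl : 0 < l) (k : ℕ) :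
    1 - steinF l k = ∑' i, poisP l (i + (k+1)) := by
  have := (poisP_hasSum hl).summable.sum_add_tsum_nat_add (k+1)
  rw [(poisP_hasSum hl).tsum_eq] at this
  unfold steinF; linarith

lemma stein_tailb {l : ℝ} (hl : 0 < l) {s : ℕ → ℝ} (h0 : ∀ i, 0 ≤ s i) (h1 : ∀ i, s i ≤ 1) (k : ℕ) :
    steinPi l s - steinA l s k = ∑' i, s (i + (k+1)) * poisP l (i + (k+1)) := by
  have := (stein_summable hl h0 h1).sum_add_tsum_nat_add (k+1)
  unfold steinPi steinA; linarith

lemma stein_b_nonneg {l : ℝ} (hl : 0 < l) {s : ℕ → ℝ} (h0 : ∀ i, 0 ≤ s i) (h1 : ∀ i, s i ≤ 1) (k : ℕ) :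
    0 ≤ steinPi l s - steinA l s k := by
  rw [stein_tailb hl h0 h1]
  exact tsum_nonneg fun i => mul_nonneg (h0 _) (poisP_pos hl _).le

lemma stein_b_le {l : ℝ} (hl : 0 < l) {s : ℕ → ℝ} (h0 : ∀ i, 0 ≤ s i) (h1 : ∀ i, s i ≤ 1) (k : ℕ) :
    steinPi l s - steinA l s k ≤ 1 - steinF l k := by
  rw [stein_tailb hl h0 h1, stein_tail hl]
  refine Summable.tsum_le_tsum (fun i => mul_le_of_le_one_left (poisP_pos hl _).le (h1 _)) ?_ ?_
  · exact (summable_nat_add_iff (f := fun i => s i * poisP l i) (k+1)).2 (stein_summable hl h0 h1)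
  · exact (summable_nat_add_iff (k+1)).2 (poisP_hasSum hl).summable

lemma stein_a_nonneg {l : ℝ} (hl : 0 < l) {s : ℕ → ℝ} (h0 : ∀ i, 0 ≤ s i) (k : ℕ) :
    0 ≤ steinA l s k := Finset.sum_nonneg fun i _ => mul_nonneg (h0 _) (poisP_pos hl _).le

lemma stein_a_le {l : ℝ} (hl : 0 < l) {s : ℕ → ℝ} (h1 : ∀ i, s i ≤ 1) (k : ℕ) :
    steinA l s k ≤ steinF l k :=
  Finset.sum_le_sum fun i _ => mul_le_of_le_one_left (poisP_pos hl _).le (h1 _)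

lemma stein_T_nonneg {l : ℝ} (hl : 0 < l) (k : ℕ) : 0 ≤ 1 - steinF l k := by
  rw [stein_tail hl]; exact tsum_nonneg fun i => (poisP_pos hl _).le

lemma stein_F_nonneg {l : ℝ} (hl : 0 < l) (k : ℕ) : 0 ≤ steinF l k :=
  Finset.sum_nonneg fun i _ => (poisP_pos hl _).le

lemma stein_T_cross {l : ℝ} (hl : 0 < l) (k : ℕ) :
    (1 - steinF l (k+1)) * poisP l k ≤ (1 - steinF l k) * poisP l (k+1) := by
  rw [stein_tail hl, stein_tail hl, ← tsum_mul_right, ← tsum_mul_right]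
  refine Summable.tsum_le_tsum (fun i => ?_) ?_ ?_
  · have := poisP_cross hl (i := k) (k := i + (k+1)) (by omega)
    rw [show i + (k+1+1) = i + (k+1) + 1 by ring]
    linarith
  · exact ((summable_nat_add_iff (k+1+1)).2 (poisP_hasSum hl).summable).mul_right _
  · exact ((summable_nat_add_iff (k+1)).2 (poisP_hasSum hl).summable).mul_right _

lemma stein_F_succ' (l : ℝ) (k : ℕ) :
    steinF l (k+1) = ∑ i ∈ Finset.range (k+1), poisP l (i+1) + poisP l 0 := by
  unfold steinF; rw [Finset.sum_range_succ']

lemma stein_F_cross {l : ℝ} (hl : 0 < l) (k : ℕ) :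
    steinF l k * poisP l (k+1) ≤ steinF l (k+1) * poisP l k := by
  rw [stein_F_succ', steinF, Finset.sum_mul, add_mul, Finset.sum_mul]
  have : ∑ i ∈ Finset.range (k+1), poisP l i * poisP l (k+1) ≤
      ∑ i ∈ Finset.range (k+1), poisP l (i+1) * poisP l k :=
    Finset.sum_le_sum fun i hi => poisP_cross hl (by simp at hi; omega)
  have := mul_pos (poisP_pos hl 0) (poisP_pos hl k)
  linarith

lemma stein_F_bound {l : ℝ} (hl : 0 < l) (k : ℕ) :
    l * steinF l k ≤ ((k:ℝ)+1) * (steinF l (k+1) - poisP l 0) := by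
  rw [stein_F_succ', steinF, add_sub_cancel_right, Finset.mul_sum, Finset.mul_sum]
  refine Finset.sum_le_sum fun i hi => ?_
  rw [← poisP_succ, mul_comm]
  have : (i:ℝ) ≤ k := by exact_mod_cast (by simp at hi; omega : i ≤ k)
  have := poisP_pos hl (i+1)
  gcongr

lemma stein_upper {l : ℝ} (hl : 0 < l) {s : ℕ → ℝ} (h0 : ∀ i, 0 ≤ s i) (h1 : ∀ i, s i ≤ 1) (k : ℕ) :
    steinG l s (k+1) - steinG l s k ≤ (1 - Real.exp (-l)) / l := by
  have hp := poisP_pos hl k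
  have hp' := poisP_pos hl (k+1)
  have hF := stein_F_bound hl k
  have hFc := stein_F_cross hl k
  have hTc := stein_T_cross hl k
  have hs := poisP_succ l k
  have ha := stein_a_nonneg hl h0 k
  have hb := stein_b_nonneg hl h0 h1 (k+1)
  have ha' : steinA l s (k+1) = steinA l s k + s (k+1) * poisP l (k+1) := by
    unfold steinA; rw [Finset.sum_range_succ]
  have hp0 : poisP l 0 = Real.exp (-l) := by simp [poisP]
  rw [← hp0]
  have hT := stein_T_nonneg hl (k+1)
  have hFn := stein_F_nonneg hl k
  have hq0 := h0 (k+1)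
  have hq1 := h1 (k+1)
  unfold steinG
  set a := steinA l s k
  set F := steinF l k
  set F' := steinF l (k+1)
  set p := poisP l k
  set p' := poisP l (k+1)
  set q := s (k+1)
  obtain ⟨b, hbe⟩ : ∃ b, b = steinPi l s - steinA l s (k+1) := ⟨_, rfl⟩
  rw [← hbe] at hb
  have hpi : steinPi l s = a + q * p' + b := by rw [hbe, ha']; ring
  rw [ha', hpi]
  have key : ((a + q * p') * (1 - F') - b * F') / p' - (a * (1 - F) - (b + q * p') * F) / p
      ≤ 1 - poisP l 0 := by
    have e1 : (1 - F') / p' ≤ (1 - F) / p := by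
      rw [div_le_div_iff₀ hp' hp]; exact hTc
    have e2 : F / p ≤ F' / p' := by
      rw [div_le_div_iff₀ hp hp']; exact hFc
    have e3 : p' * F / p ≤ F' - poisP l 0 := by
      rw [div_le_iff₀ hp]
      have hk : (0:ℝ) < k + 1 := by positivity
      have : ((k:ℝ)+1) * (p' * F) ≤ ((k:ℝ)+1) * ((F' - poisP l 0) * p) := by
        calc ((k:ℝ)+1) * (p' * F) = (p' * ((k:ℝ)+1)) * F := by ring
          _ = p * (l * F) := by rw [hs]; ring
          _ ≤ p * (((k:ℝ)+1) * (F' - poisP l 0)) := by gcongr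
          _ = _ := by ring
      exact le_of_mul_le_mul_left this hk
    have e4 : 0 ≤ p' * F / p := by positivity
    have m1 := mul_le_mul_of_nonneg_left e1 ha
    have m2 := mul_le_mul_of_nonneg_left e2 hb
    have m3 : q * ((1 - F') + p' * F / p) ≤ 1 - poisP l 0 := by nlinarith
    have : ((a + q * p') * (1 - F') - b * F') / p' - (a * (1 - F) - (b + q * p') * F) / p
      = a * ((1 - F') / p') - a * ((1-F)/p) + (b * (F/p) - b * (F'/p')) + q * ((1 - F') + p' * F / p) := by
      field_simp
      ring
    linarith
  have : (a + q * p' - (a + q * p' + b) * F') / (l * p') - (a - (a + q * p' + b) * F) / (l * p)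
     = (((a + q * p') * (1 - F') - b * F') / p' - (a * (1 - F) - (b + q * p') * F) / p) / l := by
    field_simp
    ring
  rw [this]
  gcongr

lemma steinG_compl {l : ℝ} (hl : 0 < l) {s : ℕ → ℝ} (h0 : ∀ i, 0 ≤ s i) (h1 : ∀ i, s i ≤ 1) (k : ℕ) :
    steinG l (fun i => 1 - s i) k = - steinG l s k := by
  have e1 : steinA l (fun i => 1 - s i) k = steinF l k - steinA l s k := by
    simp [steinA, steinF, sub_mul, Finset.sum_sub_distrib]
  have e2 : steinPi l (fun i => 1 - s i) = 1 - steinPi l s := by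
    simp only [steinPi, sub_mul, one_mul]
    rw [Summable.tsum_sub (poisP_hasSum hl).summable (stein_summable hl h0 h1), (poisP_hasSum hl).tsum_eq]
  unfold steinG
  rw [e1, e2]; ring

lemma stein_lip {l : ℝ} (hl : 0 < l) {s : ℕ → ℝ} (h0 : ∀ i, 0 ≤ s i) (h1 : ∀ i, s i ≤ 1) (k : ℕ) :
    |steinG l s (k+1) - steinG l s k| ≤ (1 - Real.exp (-l)) / l := by
  rw [abs_le]
  refine ⟨?_, stein_upper hl h0 h1 k⟩
  have := stein_upper hl (s := fun i => 1 - s i) (fun i => by linarith [h1 i]) (fun i => by linarith [h0 i]) k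
  rw [steinG_compl hl h0 h1, steinG_compl hl h0 h1] at this
  linarith

lemma stein_bdd {l : ℝ} (hl : 0 < l) {s : ℕ → ℝ} (h0 : ∀ i, 0 ≤ s i) (h1 : ∀ i, s i ≤ 1) (k : ℕ) :
    |steinG l s k| ≤ 1 / (l * poisP l 0) := by
  have hT : (1 - steinF l k) / poisP l k ≤ 1 / poisP l 0 := by
    induction k with
    | zero =>
      have := poisP_pos hl 0
      have := stein_F_nonneg hl 0
      gcongr; linarith
    | succ k ih =>
      refine le_trans ?_ ih
      rw [div_le_div_iff₀ (poisP_pos hl _) (poisP_pos hl _)]; exact stein_T_cross hl k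
  have hp := poisP_pos hl k
  have ha := stein_a_nonneg hl h0 k
  have ha' := stein_a_le hl h1 k
  have hb := stein_b_nonneg hl h0 h1 k
  have hb' := stein_b_le hl h0 h1 k
  have hF := stein_F_nonneg hl k
  have hT0 := stein_T_nonneg hl k
  have hN : |steinA l s k - steinPi l s * steinF l k| ≤ 1 - steinF l k := by
    rw [abs_le]; constructor <;> nlinarith
  unfold steinG
  rw [abs_div, abs_of_pos (mul_pos hl hp)]
  calc _ ≤ (1 - steinF l k) / (l * poisP l k) := by gcongr
    _ = ((1 - steinF l k) / poisP l k) / l := by field_simp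
    _ ≤ (1 / poisP l 0) / l := by gcongr
    _ = _ := by have := poisP_pos hl 0; field_simp

lemma stein_eq_zero {l : ℝ} (hl : 0 < l) (s : ℕ → ℝ) :
    l * steinG l s 0 = s 0 - steinPi l s := by
  have := poisP_pos hl 0
  simp [steinG, steinA, steinF]
  field_simp

lemma stein_eq_succ {l : ℝ} (hl : 0 < l) (s : ℕ → ℝ) (k : ℕ) :
    l * steinG l s (k+1) - ((k:ℝ)+1) * steinG l s k = s (k+1) - steinPi l s := by
  have hp := poisP_pos hl k
  have hp' := poisP_pos hl (k+1)
  have hs := poisP_succ l k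
  have hk : (0:ℝ) < k + 1 := by positivity
  have ha' : steinA l s (k+1) = steinA l s k + s (k+1) * poisP l (k+1) := by
    unfold steinA; rw [Finset.sum_range_succ]
  have hF' : steinF l (k+1) = steinF l k + poisP l (k+1) := by
    unfold steinF; rw [Finset.sum_range_succ]
  unfold steinG
  rw [ha', hF', ← hs]
  field_simp
  ring

lemma stein_lip' {l : ℝ} (hl : 0 < l) {s : ℕ → ℝ} (h0 : ∀ i, 0 ≤ s i) (h1 : ∀ i, s i ≤ 1) (j k : ℕ) :
    |steinG l s j - steinG l s k| ≤ (1 - Real.exp (-l)) / l * |(j:ℝ) - k| := by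
  have aux : ∀ k d : ℕ, |steinG l s (k+d) - steinG l s k| ≤ (1 - Real.exp (-l)) / l * d := by
    intro k d
    induction d with
    | zero => simp
    | succ d ih =>
      have h := stein_lip hl h0 h1 (k+d)
      have := abs_sub_le (steinG l s (k+d+1)) (steinG l s (k+d)) (steinG l s k)
      rw [show k + (d+1) = k+d+1 by ring]
      push_cast
      linarith
  rcases le_total k j with h | h
  · obtain ⟨d, rfl⟩ := Nat.exists_eq_add_of_le h
    have := aux k d
    push_cast
    rwa [add_sub_cancel_left, abs_of_nonneg (by positivity : (0:ℝ) ≤ d)]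
  · obtain ⟨d, rfl⟩ := Nat.exists_eq_add_of_le h
    have := aux j d
    rw [abs_sub_comm, abs_sub_comm (j:ℝ)]
    push_cast
    rwa [add_sub_cancel_left, abs_of_nonneg (by positivity : (0:ℝ) ≤ d)]

/-- Poisson approximation via size bias couplings (Chen; Barbour–Holst–Janson).
Let `X` be a nonnegative integer-valued random variable with
`l := E X ∈ (0,∞)` and let `Z` be Poisson with parameter `l`.  Then for any
coupling of `X` with `X*` (both defined on a common probability space, `X*`
having the size-biased distribution of `X`),
`d_TV(X, Z) ≤ (1 - e^{-l}) · E |X* - (X+1)|`, where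
`d_TV(X, Z) = sup_B (P(X ∈ B) - P(Z ∈ B))` over Borel sets `B`. -/
theorem stmt11 {Ω : Type*} [MeasurableSpace Ω] (P : Measure Ω) [IsProbabilityMeasure P]
    (X Xs : Ω → ℝ) (hX : Measurable X) (hXs : Measurable Xs)
    (hint : ∀ ω, ∃ k : ℕ, X ω = k)
    (hInt : Integrable X P)
    (l : ℝ) (hl : l = ∫ ω, X ω ∂P) (hlpos : 0 < l)
    (hsb : Measure.map Xs P = sizeBiasedLaw (Measure.map X P)) :
    (⨆ (B : Set ℝ) (_ : MeasurableSet B),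
        (Measure.map X P B -
          (Measure.sum fun k : ℕ =>
            ENNReal.ofReal (Real.exp (-l) * l ^ k / (Nat.factorial k)) •
              Measure.dirac ((k : ℝ))) B)) ≤
      ENNReal.ofReal (1 - Real.exp (-l)) *
        ∫⁻ ω, ENNReal.ofReal |Xs ω - (X ω + 1)| ∂P := by
  classical
  have hc : 0 < 1 - Real.exp (-l) := by
    have : Real.exp (-l) < 1 := by rw [← Real.exp_zero]; exact Real.exp_lt_exp.2 (by linarith)
    linarith
  by_cases hfin : ∫⁻ ω, ENNReal.ofReal |Xs ω - (X ω + 1)| ∂P = ⊤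
  · rw [hfin, ENNReal.mul_top (by simpa using hc)]
    exact le_top
  have hDint : Integrable (fun ω => |Xs ω - (X ω + 1)|) P := by
    refine ⟨by fun_prop, ?_⟩
    rw [hasFiniteIntegral_iff_ofReal (Filter.Eventually.of_forall fun ω => abs_nonneg _)]
    exact lt_top_iff_ne_top.2 hfin
  rw [← ofReal_integral_eq_lintegral_ofReal hDint
    (Filter.Eventually.of_forall fun ω => abs_nonneg _), ← ENNReal.ofReal_mul hc.le]
  refine iSup₂_le fun B hB => ?_
  -- the indicator on the integers
  set s : ℕ → ℝ := fun i => B.indicator 1 (i : ℝ) with hs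
  have h0 : ∀ i, 0 ≤ s i := fun i => Set.indicator_nonneg (fun _ _ => by simp) _
  have h1 : ∀ i, s i ≤ 1 := fun i => Set.indicator_le' (fun _ _ => le_rfl) (fun _ _ => by simp) _
  have hpois : (Measure.sum fun k : ℕ =>
            ENNReal.ofReal (Real.exp (-l) * l ^ k / (Nat.factorial k)) •
              Measure.dirac ((k : ℝ))) B = ENNReal.ofReal (steinPi l s) := by
    rw [Measure.sum_apply _ hB, steinPi, ENNReal.ofReal_tsum_of_nonneg
      (fun i => mul_nonneg (h0 i) (poisP_pos hlpos i).le) (stein_summable hlpos h0 h1)]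
    refine tsum_congr fun i => ?_
    rw [Measure.smul_apply, Measure.dirac_apply' _ hB, smul_eq_mul]
    by_cases hi : (i:ℝ) ∈ B <;> simp [hs, hi, poisP]
  rw [hpois]
  have hPi0 : 0 ≤ steinPi l s := tsum_nonneg fun i => mul_nonneg (h0 i) (poisP_pos hlpos i).le
  set g := steinG l s with hg
  set C := 1 / (l * poisP l 0) with hC
  let f : ℝ → ℝ := fun x => g (⌊x⌋₊ - 1)
  have hfm : Measurable f := (measurable_from_nat (f := fun n : ℕ => g (n - 1))).comp Nat.measurable_floor
  have hfb : ∀ x, ‖f x‖ ≤ C := fun x => stein_bdd hlpos h0 h1 _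
  have hlmap : ∫ y, y ∂(Measure.map X P) = l := by
    rw [hl, integral_map hX.aemeasurable (by fun_prop)]
  have hXs1 : ∀ᵐ ω ∂P, ∃ k : ℕ, Xs ω = (k:ℝ) + 1 := by
    have hms : MeasurableSet {x : ℝ | ∃ k : ℕ, x = (k:ℝ) + 1} := by
      have : {x : ℝ | ∃ k : ℕ, x = (k:ℝ) + 1} = Set.range (fun k : ℕ => (k:ℝ) + 1) := by
        ext x; simp [eq_comm]
      rw [this]
      exact (Set.countable_range _).measurableSet
    rw [← ae_map_iff hXs.aemeasurable hms, hsb, sizeBiasedLaw,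
      ae_withDensity_iff (by fun_prop), ae_map_iff hX.aemeasurable]
    · refine Filter.Eventually.of_forall fun ω hω => ?_
      obtain ⟨k, hk⟩ := hint ω
      rcases k with _ | k
      · rw [hk] at hω; simp at hω
      · exact ⟨k, by rw [hk]; push_cast; ring⟩
    · have : MeasurableSet {x : ℝ | ENNReal.ofReal (x / ∫ y, y ∂(Measure.map X P)) = 0} :=
        measurableSet_eq_fun (by fun_prop) (by fun_prop)
      have e : {x : ℝ | ENNReal.ofReal (x / ∫ y, y ∂(Measure.map X P)) ≠ 0 → ∃ k : ℕ, x = (k:ℝ) + 1}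
        = {x : ℝ | ENNReal.ofReal (x / ∫ y, y ∂(Measure.map X P)) = 0} ∪
          {x : ℝ | ∃ k : ℕ, x = (k:ℝ) + 1} := by
        ext x; simp only [Set.mem_ofPred_eq, Set.mem_union]; tauto
      rw [e]; exact this.union hms
  have hbias : ∫ ω, f (Xs ω) ∂P = (∫ ω, X ω * f (X ω) ∂P) / l := by
    rw [← integral_map (f := f) hXs.aemeasurable hfm.aestronglyMeasurable, hsb, sizeBiasedLaw,
      integral_withDensity_eq_integral_toReal_smul (by fun_prop)
        (Filter.Eventually.of_forall fun x => ENNReal.ofReal_lt_top),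
      integral_map hX.aemeasurable (by fun_prop), hlmap, ← integral_div]
    refine integral_congr_ae (Filter.Eventually.of_forall fun ω => ?_)
    obtain ⟨k, hk⟩ := hint ω
    have : 0 ≤ X ω / l := by rw [hk]; positivity
    simp only [smul_eq_mul]
    rw [ENNReal.toReal_ofReal this]; ring
  have i1 : Integrable (fun ω => f (Xs ω)) P :=
    Integrable.of_bound (hfm.comp hXs).aestronglyMeasurable C (Filter.Eventually.of_forall fun ω => hfb _)
  have i2 : Integrable (fun ω => f (X ω + 1)) P :=
    Integrable.of_bound (hfm.comp (hX.add_const 1)).aestronglyMeasurable C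
      (Filter.Eventually.of_forall fun ω => hfb _)
  have i3 : Integrable (fun ω => X ω * f (X ω)) P :=
    hInt.mul_bdd (c := C) (hfm.comp hX).aestronglyMeasurable (Filter.Eventually.of_forall fun ω => hfb _)
  have hstein : ∀ ω, l * f (X ω + 1) - X ω * f (X ω) = (X ⁻¹' B).indicator 1 ω - steinPi l s := by
    intro ω
    obtain ⟨k, hk⟩ := hint ω
    have e0 : (X ⁻¹' B).indicator (1 : Ω → ℝ) ω = s k := by
      rw [hs]; simp only [Set.indicator, Set.mem_preimage, hk, Pi.one_apply]
    have e1 : f (X ω + 1) = g k := by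
      simp only [f, hk]
      rw [show (k:ℝ) + 1 = ((k+1 : ℕ) : ℝ) by push_cast; ring, Nat.floor_natCast]; simp
    rw [e0, e1]
    rcases k with _ | k
    · rw [hk]; simpa using stein_eq_zero hlpos s
    · have e2 : f (X ω) = g k := by
        simp only [f, hk, Nat.floor_natCast]; simp
      rw [e2, hk, ← stein_eq_succ hlpos s k]; push_cast; ring
  have hP : P.real (X ⁻¹' B) - steinPi l s = l * ∫ ω, (f (X ω + 1) - f (Xs ω)) ∂P := by
    have hXB := hX hB
    rw [integral_sub i2 i1, hbias, mul_sub, mul_div_cancel₀ _ hlpos.ne', ← integral_const_mul,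
      ← integral_sub (i2.const_mul l) i3]
    simp only [hstein]
    have i4 : Integrable ((X ⁻¹' B).indicator (1 : Ω → ℝ)) P :=
      (integrable_const (1:ℝ)).indicator hXB
    rw [integral_sub i4 (integrable_const _), integral_indicator_one hXB]
    simp
  have hle : ∫ ω, (f (X ω + 1) - f (Xs ω)) ∂P ≤
      ∫ ω, (1 - Real.exp (-l)) / l * |Xs ω - (X ω + 1)| ∂P := by
    refine integral_mono_ae (i2.sub i1) (hDint.const_mul _) ?_
    filter_upwards [hXs1] with ω ⟨j, hj⟩
    obtain ⟨k, hk⟩ := hint ω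
    have e1 : f (X ω + 1) = g k := by
      simp only [f, hk]
      rw [show (k:ℝ) + 1 = ((k+1 : ℕ) : ℝ) by push_cast; ring, Nat.floor_natCast]; simp
    have e2 : f (Xs ω) = g j := by
      simp only [f, hj]
      rw [show (j:ℝ) + 1 = ((j+1 : ℕ) : ℝ) by push_cast; ring, Nat.floor_natCast]; simp
    rw [e1, e2, hj, hk, abs_sub_comm]
    have := (le_abs_self _).trans (stein_lip' hlpos h0 h1 k j)
    rwa [show (k:ℝ) + 1 - (j + 1) = k - j by ring]
  rw [Measure.map_apply hX hB, ← ofReal_measureReal, ← ENNReal.ofReal_sub _ hPi0]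
  refine ENNReal.ofReal_le_ofReal ?_
  rw [hP]
  calc _ ≤ l * ∫ ω, (1 - Real.exp (-l)) / l * |Xs ω - (X ω + 1)| ∂P := by gcongr
    _ = _ := by rw [integral_const_mul]; field_simp
end

section
/- Let X ≥ 0 be a random variable with a := E X ∈ (0,∞), and suppose X* (having the size-biased distribution of X) is coupled to X on the same probability space so that P(X* ≤ X + c) = 1 for some constant c > 0. Then for all x ≥ a, P(X ≥ x) ≤ (a/x)^{x/c} e^{(x−a)/c} ≤ exp(−(x−a)²/(c(a+x))). -/
open MeasureTheory

open ProbabilityTheory in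
lemma mgf_bound_aux {Ω : Type*} [MeasurableSpace Ω] (P : Measure Ω) [IsProbabilityMeasure P]
    (Y : Ω → ℝ) (hY : Measurable Y) (x a c : ℝ) (hc : 0 < c)
    (hb : ∀ ω, Y ω ∈ Set.Icc 0 x)
    (h : ∀ t : ℝ, 0 ≤ t → ∫ ω, Y ω * Real.exp (t * Y ω) ∂P ≤ a * Real.exp (c * t) * mgf Y P t)
    (t : ℝ) (ht : 0 ≤ t) : mgf Y P t ≤ Real.exp (a / c * (Real.exp (c * t) - 1)) := by
  have hint : ∀ t : ℝ, Integrable (fun ω => Real.exp (t * Y ω)) P := fun t =>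
    integrable_exp_mul_of_mem_Icc hY.aemeasurable (Filter.Eventually.of_forall hb)
  have hset : integrableExpSet Y P = Set.univ := by
    ext t; simpa [integrableExpSet] using hint t
  have hd : ∀ t : ℝ, HasDerivAt (fun t => mgf Y P t * Real.exp (-(a / c) * Real.exp (c * t)))
      ((∫ ω, Y ω * Real.exp (t * Y ω) ∂P) * Real.exp (-(a / c) * Real.exp (c * t)) +
        mgf Y P t * (Real.exp (-(a / c) * Real.exp (c * t)) *
          (-(a / c) * (Real.exp (c * t) * (c * 1))))) t := by
    intro t
    have h1 : HasDerivAt (mgf Y P) (∫ ω, Y ω * Real.exp (t * Y ω) ∂P) t :=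
      hasDerivAt_mgf (by simp [hset])
    exact h1.mul ((((hasDerivAt_id t).const_mul c).exp.const_mul (-(a / c))).exp)
  have hanti : AntitoneOn (fun t => mgf Y P t * Real.exp (-(a / c) * Real.exp (c * t)))
      (Set.Ici 0) := by
    apply antitoneOn_of_deriv_nonpos (convex_Ici 0)
    · exact fun t _ => (hd t).continuousAt.continuousWithinAt
    · exact fun t _ => (hd t).differentiableAt.differentiableWithinAt
    · intro t ht
      rw [interior_Ici] at ht
      rw [(hd t).deriv]
      have h2 := h t (le_of_lt ht)
      have e : mgf Y P t * (Real.exp (-(a / c) * Real.exp (c * t)) *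
          (-(a / c) * (Real.exp (c * t) * (c * 1)))) =
          -(a * Real.exp (c * t) * mgf Y P t) * Real.exp (-(a / c) * Real.exp (c * t)) := by
        field_simp
      rw [e, ← add_mul]
      exact mul_nonpos_of_nonpos_of_nonneg (by linarith) (Real.exp_pos _).le
  have h3 := hanti (Set.mem_Ici.2 le_rfl) (Set.mem_Ici.2 ht) ht
  simp only [mgf_zero, mul_zero, Real.exp_zero, one_mul, mul_one] at h3
  have h4 : mgf Y P t = mgf Y P t * Real.exp (-(a / c) * Real.exp (c * t)) *
      Real.exp (a / c * Real.exp (c * t)) := by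
    rw [mul_assoc, ← Real.exp_add]; simp
  rw [h4]
  refine (mul_le_mul_of_nonneg_right h3 (Real.exp_pos _).le).trans (le_of_eq ?_)
  rw [← Real.exp_add]; congr 1; ring

lemma sizeBias_aux {Ω : Type*} [MeasurableSpace Ω] (P : Measure Ω)
    (X Xs : Ω → ℝ) (hX : Measurable X) (hXs : Measurable Xs) (hnn : ∀ ω, 0 ≤ X ω)
    (a : ℝ) (ha : a = ∫ ω, X ω ∂P) (hapos : 0 < a)
    (hsb : Measure.map Xs P = sizeBiasedLaw (Measure.map X P))
    (g : ℝ → ℝ) (hg : Measurable g) :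
    ∫ ω, X ω * g (X ω) ∂P = a * ∫ ω, g (Xs ω) ∂P := by
  have hm : ∫ y, y ∂(Measure.map X P) = a := by
    rw [integral_map hX.aemeasurable (by fun_prop), ha]
  have h1 : ∫ ω, g (Xs ω) ∂P = ∫ y, g y ∂(Measure.map Xs P) :=
    (integral_map hXs.aemeasurable hg.aestronglyMeasurable).symm
  rw [h1, hsb, sizeBiasedLaw, hm, integral_withDensity_eq_integral_toReal_smul (by fun_prop)
    (by simp), integral_map hX.aemeasurable (by fun_prop), ← integral_const_mul]
  congr 1; ext ω
  rw [ENNReal.toReal_ofReal (div_nonneg (hnn ω) hapos.le), smul_eq_mul]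
  field_simp

/-- Upper-tail concentration from a bounded size bias coupling.  Let `X ≥ 0`
with `a := E X ∈ (0,∞)` and suppose `X*` (with the size-biased distribution
of `X`) is coupled to `X` so that `P(X* ≤ X + c) = 1` for some `c > 0`.  Then
for all `x ≥ a`,
`P(X ≥ x) ≤ (a/x)^{x/c} e^{(x-a)/c} ≤ exp(-(x-a)²/(c(a+x)))`. -/
theorem stmt12 {Ω : Type*} [MeasurableSpace Ω] (P : Measure Ω) [IsProbabilityMeasure P]
    (X Xs : Ω → ℝ) (hX : Measurable X) (hXs : Measurable Xs)
    (hnn : ∀ ω, 0 ≤ X ω) (hInt : Integrable X P)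
    (a : ℝ) (ha : a = ∫ ω, X ω ∂P) (hapos : 0 < a)
    (hsb : Measure.map Xs P = sizeBiasedLaw (Measure.map X P))
    (c : ℝ) (hc : 0 < c)
    (hcoup : P {ω | Xs ω ≤ X ω + c} = 1) :
    ∀ x : ℝ, a ≤ x →
      (P {ω | x ≤ X ω}).toReal ≤ (a / x) ^ (x / c) * Real.exp ((x - a) / c) ∧
      (a / x) ^ (x / c) * Real.exp ((x - a) / c) ≤
        Real.exp (-(x - a) ^ 2 / (c * (a + x))) := by
  intro x hx
  have hxpos : 0 < x := hapos.trans_le hx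
  have hau : 0 < a / x := div_pos hapos hxpos
  constructor
  · set Y : Ω → ℝ := fun ω => min (X ω) x with hYdef
    have hY : Measurable Y := hX.min measurable_const
    have hb : ∀ ω, Y ω ∈ Set.Icc 0 x := fun ω => ⟨le_min (hnn ω) hxpos.le, min_le_right _ _⟩
    have hae : ∀ᵐ ω ∂P, Xs ω ≤ X ω + c := by
      rw [← prob_compl_eq_zero_iff (measurableSet_le hXs (hX.add_const c))] at hcoup
      exact hcoup
    have key : ∀ t : ℝ, 0 ≤ t → ∫ ω, Y ω * Real.exp (t * Y ω) ∂P ≤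
        a * Real.exp (c * t) * ProbabilityTheory.mgf Y P t := by
      intro t ht
      have hbd : ∀ ω, ‖Real.exp (t * Y ω)‖ ≤ Real.exp (t * x) := by
        intro ω
        rw [Real.norm_eq_abs, abs_of_pos (Real.exp_pos _)]
        exact Real.exp_le_exp.2 (mul_le_mul_of_nonneg_left (hb ω).2 ht)
      have hi1 : Integrable (fun ω => Real.exp (t * Y ω)) P :=
        Integrable.of_bound (by fun_prop) _ (Filter.Eventually.of_forall hbd)
      have hi2 : Integrable (fun ω => X ω * Real.exp (t * Y ω)) P :=
        hInt.mul_bdd (c := Real.exp (t * x)) (by fun_prop) (Filter.Eventually.of_forall hbd)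
      have hi3 : Integrable (fun ω => Real.exp (t * min (Xs ω) x)) P := by
        refine Integrable.of_bound (C := Real.exp (t * x)) (by fun_prop)
          (Filter.Eventually.of_forall fun ω => ?_)
        rw [Real.norm_eq_abs, abs_of_pos (Real.exp_pos _)]
        exact Real.exp_le_exp.2 (mul_le_mul_of_nonneg_left (min_le_right _ _) ht)
      have hi4 : Integrable (fun ω => Y ω * Real.exp (t * Y ω)) P := by
        refine hi2.mono (by fun_prop) (Filter.Eventually.of_forall fun ω => ?_)
        rw [norm_mul, norm_mul]
        refine mul_le_mul_of_nonneg_right ?_ (norm_nonneg _)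
        rw [Real.norm_eq_abs, Real.norm_eq_abs, abs_of_nonneg (hb ω).1, abs_of_nonneg (hnn ω)]
        exact min_le_left _ _
      have s1 : ∫ ω, Y ω * Real.exp (t * Y ω) ∂P ≤ ∫ ω, X ω * Real.exp (t * Y ω) ∂P :=
        integral_mono hi4 hi2 fun ω =>
          mul_le_mul_of_nonneg_right (min_le_left _ _) (Real.exp_pos _).le
      have s2 := sizeBias_aux P X Xs hX hXs hnn a ha hapos hsb
        (fun y => Real.exp (t * min y x)) (by fun_prop)
      have s3 : ∫ ω, Real.exp (t * min (Xs ω) x) ∂P ≤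
          ∫ ω, Real.exp (c * t) * Real.exp (t * Y ω) ∂P := by
        refine integral_mono_ae hi3 (hi1.const_mul _) ?_
        filter_upwards [hae] with ω hω
        rw [← Real.exp_add]
        apply Real.exp_le_exp.2
        have : min (Xs ω) x ≤ c + min (X ω) x := by
          rcases le_total (X ω) x with h | h
          · rw [min_eq_left h]; exact (min_le_left _ _).trans (by linarith)
          · rw [min_eq_right h]; exact (min_le_right _ _).trans (by linarith)
        calc t * min (Xs ω) x ≤ t * (c + min (X ω) x) := mul_le_mul_of_nonneg_left this ht
          _ = _ := by simp only [hYdef]; ring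
      rw [integral_const_mul] at s3
      calc _ ≤ _ := s1
        _ = _ := s2
        _ ≤ a * (Real.exp (c * t) * ∫ ω, Real.exp (t * Y ω) ∂P) :=
          mul_le_mul_of_nonneg_left s3 hapos.le
        _ = _ := by rw [ProbabilityTheory.mgf]; ring
    set t := Real.log (x / a) / c with htdef
    have ht : 0 ≤ t := div_nonneg (Real.log_nonneg ((one_le_div hapos).2 hx)) hc.le
    have hct : Real.exp (c * t) = x / a := by
      rw [htdef, mul_div_cancel₀ _ hc.ne', Real.exp_log (div_pos hxpos hapos)]
    have hm := mgf_bound_aux P Y hY x a c hc hb key t ht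
    have hch := ProbabilityTheory.measure_ge_le_exp_mul_mgf (μ := P) (X := Y) x ht
      (ProbabilityTheory.integrable_exp_mul_of_mem_Icc hY.aemeasurable
        (Filter.Eventually.of_forall hb))
    have hs : {ω | x ≤ Y ω} = {ω | x ≤ X ω} := by
      ext ω; simp [hYdef]
    rw [hs] at hch
    refine hch.trans ((mul_le_mul_of_nonneg_left hm (Real.exp_pos _).le).trans (le_of_eq ?_))
    rw [hct, Real.rpow_def_of_pos hau]
    congr 2
    · rw [htdef, ← inv_div x a, Real.log_inv]; ring
    · field_simp
  · rw [Real.rpow_def_of_pos hau, ← Real.exp_add]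
    apply Real.exp_le_exp.2
    have h := Real.le_log_one_add_of_nonneg (x := x / a - 1)
      (by have := (one_le_div hapos).2 hx; linarith)
    rw [← inv_div x a, Real.log_inv]
    rw [add_sub_cancel] at h
    have e : 2 * (x / a - 1) / (x / a - 1 + 2) = 2 * (x - a) / (a + x) := by
      have : x / a - 1 + 2 = (a + x) / a := by field_simp; ring
      rw [this]; field_simp
    rw [e] at h
    have h5 := mul_le_mul_of_nonneg_right h (div_pos hxpos hc).le
    have e2 : -(x - a) ^ 2 / (c * (a + x)) =
        (x - a) / c - 2 * (x - a) / (a + x) * (x / c) := by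
      have : a + x ≠ 0 := by positivity
      field_simp; ring
    rw [e2]; linarith
end

section
/- Let X ≥ 0 be a random variable with a := E X ∈ (0,∞), and suppose X* (having the size-biased distribution of X) is coupled to X on the same probability space so that P(X* ≤ X + c) = 1 for some constant c > 0. Then for all x with 0 < x ≤ a, P(X ≤ x) ≤ (a/x)^{x/c} e^{(x−a)/c} ≤ exp(−(a−x)²/(2ca)). -/
open MeasureTheory

open ProbabilityTheory

lemma aux_sb {Ω : Type*} [MeasurableSpace Ω] (P : Measure Ω) [IsProbabilityMeasure P]
    (X Xs : Ω → ℝ) (hX : Measurable X) (hXs : Measurable Xs)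
    (hnn : ∀ ω, 0 ≤ X ω)
    (a : ℝ) (ha : a = ∫ ω, X ω ∂P) (hapos : 0 < a)
    (hsb : Measure.map Xs P = sizeBiasedLaw (Measure.map X P)) (g : ℝ → ℝ) (hg : Measurable g) :
    ∫ ω, X ω * g (X ω) ∂P = a * ∫ ω, g (Xs ω) ∂P := by
  have h1 : ∫ ω, g (Xs ω) ∂P = ∫ y, g y ∂(Measure.map Xs P) :=
    (integral_map hXs.aemeasurable hg.aestronglyMeasurable).symm
  have h2 : ∫ y, y ∂(Measure.map X P) = a := by
    rw [integral_map hX.aemeasurable (by fun_prop), ha]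
  rw [h1, hsb, sizeBiasedLaw, h2,
    integral_withDensity_eq_integral_toReal_smul (by fun_prop) (by simp),
    integral_map hX.aemeasurable (by fun_prop), ← integral_const_mul]
  congr 1
  ext ω
  rw [ENNReal.toReal_ofReal (div_nonneg (hnn ω) hapos.le), smul_eq_mul]
  field_simp

lemma aux_nonneg_sb {Ω : Type*} [MeasurableSpace Ω] (P : Measure Ω) [IsProbabilityMeasure P]
    (X Xs : Ω → ℝ) (hX : Measurable X) (hXs : Measurable Xs)
    (hnn : ∀ ω, 0 ≤ X ω)
    (hsb : Measure.map Xs P = sizeBiasedLaw (Measure.map X P)) :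
    ∀ᵐ ω ∂P, 0 ≤ Xs ω := by
  have h : ∀ᵐ y ∂(Measure.map Xs P), 0 ≤ y := by
    rw [hsb, sizeBiasedLaw]
    apply (withDensity_absolutelyContinuous _ _).ae_le
    change ∀ᵐ y ∂(Measure.map X P), 0 ≤ y
    rw [ae_map_iff hX.aemeasurable measurableSet_Ici]
    exact Filter.Eventually.of_forall hnn
  exact ae_of_ae_map hXs.aemeasurable h

lemma aux_int {Ω : Type*} [MeasurableSpace Ω] (P : Measure Ω) [IsProbabilityMeasure P]
    (Y : Ω → ℝ) (hY : Measurable Y) (hnn : ∀ᵐ ω ∂P, 0 ≤ Y ω) (t : ℝ) (ht : 0 ≤ t) :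
    Integrable (fun ω => Real.exp (t * (-Y) ω)) P := by
  refine Integrable.of_bound (C := 1) (by fun_prop) ?_
  filter_upwards [hnn] with ω h
  rw [Real.norm_eq_abs, abs_of_pos (Real.exp_pos _), Real.exp_le_one_iff, Pi.neg_apply]
  nlinarith

lemma aux_mgf {Ω : Type*} [MeasurableSpace Ω] (P : Measure Ω) [IsProbabilityMeasure P]
    (X Xs : Ω → ℝ) (hX : Measurable X) (hXs : Measurable Xs)
    (hnn : ∀ ω, 0 ≤ X ω)
    (a : ℝ) (ha : a = ∫ ω, X ω ∂P) (hapos : 0 < a)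
    (hsb : Measure.map Xs P = sizeBiasedLaw (Measure.map X P))
    (c : ℝ) (hc : 0 < c)
    (hcoup : ∀ᵐ ω ∂P, Xs ω ≤ X ω + c) (t : ℝ) (ht : 0 ≤ t) :
    mgf (-X) P t ≤ Real.exp (-(a * (1 - Real.exp (-t * c)) / c)) := by
  have hXint := fun s hs => aux_int P X hX (Filter.Eventually.of_forall hnn) s hs
  have hXsint := fun s hs => aux_int P Xs hXs (aux_nonneg_sb P X Xs hX hXs hnn hsb) s hs
  have hcont : ContinuousOn (mgf (-X) P) (Set.Ici 0) := by
    intro s hs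
    refine continuousWithinAt_of_dominated (bound := fun _ => 1) ?_ ?_ (integrable_const _) ?_
    · exact Filter.Eventually.of_forall fun s => by fun_prop
    · filter_upwards [self_mem_nhdsWithin] with s hs
      refine Filter.Eventually.of_forall fun ω => ?_
      rw [Real.norm_eq_abs, abs_of_pos (Real.exp_pos _), Real.exp_le_one_iff, Pi.neg_apply]
      have := hnn ω
      have : 0 ≤ s := hs
      nlinarith
    · refine Filter.Eventually.of_forall fun ω => ?_
      fun_prop
  have hder : ∀ s, 0 < s → HasDerivAt (mgf (-X) P)
      (-(a * ∫ ω, Real.exp (s * (-Xs) ω) ∂P)) s := by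
    intro s hs
    have hmem : s ∈ interior (integrableExpSet (-X) P) := by
      rw [mem_interior]
      exact ⟨Set.Ioi 0, fun u hu => hXint u (le_of_lt hu), isOpen_Ioi, hs⟩
    have h := hasDerivAt_mgf hmem
    convert h using 1
    have h3 := aux_sb P X Xs hX hXs hnn a ha hapos hsb (fun y => Real.exp (s * (-y))) (by fun_prop)
    simp only [Pi.neg_apply]
    rw [← h3, ← integral_neg]
    simp
  have hle : ∀ s, 0 < s → Real.exp (-s * c) * mgf (-X) P s ≤
      ∫ ω, Real.exp (s * (-Xs) ω) ∂P := by
    intro s hs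
    rw [mgf, ← integral_const_mul]
    refine integral_mono_ae ((hXint s hs.le).const_mul _) (hXsint s hs.le) ?_
    filter_upwards [hcoup] with ω h
    rw [← Real.exp_add, Real.exp_le_exp, Pi.neg_apply, Pi.neg_apply]
    nlinarith
  have hE : ∀ s : ℝ, HasDerivAt (fun s => Real.exp (a * (1 - Real.exp (-s * c)) / c))
      (Real.exp (a * (1 - Real.exp (-s * c)) / c) * (a * Real.exp (-s * c))) s := by
    intro s
    have h0 : HasDerivAt (fun s : ℝ => -s * c) (-c) s := by
      simpa using ((hasDerivAt_id s).neg.mul_const c)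
    have := (((h0.exp.const_sub 1).const_mul a).div_const c).exp
    convert this using 1
    field_simp
  have hanti : AntitoneOn (fun s => mgf (-X) P s * Real.exp (a * (1 - Real.exp (-s * c)) / c))
      (Set.Ici 0) := by
    refine antitoneOn_of_hasDerivWithinAt_nonpos (convex_Ici 0)
      (hcont.mul (by fun_prop)) (f' := fun s => -(a * ∫ ω, Real.exp (s * (-Xs) ω) ∂P) *
        Real.exp (a * (1 - Real.exp (-s * c)) / c) + mgf (-X) P s *
        (Real.exp (a * (1 - Real.exp (-s * c)) / c) * (a * Real.exp (-s * c)))) ?_ ?_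
    · intro s hs
      rw [interior_Ici] at hs
      exact ((hder s hs).mul (hE s)).hasDerivWithinAt
    · intro s hs
      rw [interior_Ici] at hs
      have h1 := mul_le_mul_of_nonneg_left (hle s hs)
        (mul_pos hapos (Real.exp_pos (a * (1 - Real.exp (-s * c)) / c))).le
      linarith
  have h := hanti (Set.mem_Ici.2 le_rfl) (Set.mem_Ici.2 ht) ht
  simp only [mgf_zero, neg_zero, zero_mul, Real.exp_zero, sub_self, mul_zero, zero_div,
    mul_one] at h
  rw [Real.exp_neg, ← one_div, le_div_iff₀ (Real.exp_pos _)]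
  simpa using h

/-- Lower-tail concentration from a bounded size bias coupling.  Let `X ≥ 0`
with `a := E X ∈ (0,∞)` and suppose `X*` (with the size-biased distribution
of `X`) is coupled to `X` so that `P(X* ≤ X + c) = 1` for some `c > 0`.  Then
for all `0 < x ≤ a`,
`P(X ≤ x) ≤ (a/x)^{x/c} e^{(x-a)/c} ≤ exp(-(a-x)²/(2ca))`. -/
theorem stmt13 {Ω : Type*} [MeasurableSpace Ω] (P : Measure Ω) [IsProbabilityMeasure P]
    (X Xs : Ω → ℝ) (hX : Measurable X) (hXs : Measurable Xs)
    (hnn : ∀ ω, 0 ≤ X ω) (hInt : Integrable X P)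
    (a : ℝ) (ha : a = ∫ ω, X ω ∂P) (hapos : 0 < a)
    (hsb : Measure.map Xs P = sizeBiasedLaw (Measure.map X P))
    (c : ℝ) (hc : 0 < c)
    (hcoup : P {ω | Xs ω ≤ X ω + c} = 1) :
    ∀ x : ℝ, 0 < x → x ≤ a →
      (P {ω | X ω ≤ x}).toReal ≤ (a / x) ^ (x / c) * Real.exp ((x - a) / c) ∧
      (a / x) ^ (x / c) * Real.exp ((x - a) / c) ≤
        Real.exp (-(a - x) ^ 2 / (2 * c * a)) := by

  intro x hx hxa
  have hcoup' : ∀ᵐ ω ∂P, Xs ω ≤ X ω + c := by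
    rw [← prob_compl_eq_zero_iff (measurableSet_le hXs (hX.add_const c))] at hcoup
    exact hcoup
  have hs : 1 ≤ a / x := (one_le_div hx).2 hxa
  have hs0 : 0 < a / x := by positivity
  have hL : 0 ≤ Real.log (a / x) := Real.log_nonneg hs
  rw [Real.rpow_def_of_pos hs0]
  constructor
  · have ht : 0 ≤ Real.log (a / x) / c := by positivity
    have h1 := aux_mgf P X Xs hX hXs hnn a ha hapos hsb c hc hcoup' _ ht
    have h2 := measure_ge_le_exp_mul_mgf (X := -X) (μ := P) (-x) ht
      (aux_int P X hX (Filter.Eventually.of_forall hnn) _ ht)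
    have h3 : {ω | -x ≤ (-X) ω} = {ω | X ω ≤ x} := by
      ext ω; simp
    rw [h3] at h2
    refine h2.trans ?_
    have e1 : -(Real.log (a / x) / c) * -x = Real.log (a / x) * (x / c) := by ring
    have e2 : -(Real.log (a / x) / c) * c = -Real.log (a / x) := by field_simp
    rw [e2, Real.exp_neg (Real.log (a / x)), Real.exp_log hs0] at h1
    have e3 : -(a * (1 - (a / x)⁻¹) / c) = (x - a) / c := by field_simp; ring
    rw [e3] at h1
    rw [e1]
    gcongr
  · rw [← Real.exp_add, Real.exp_le_exp]
    have h := Real.self_le_sinh_iff.2 hL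
    rw [Real.sinh_eq, Real.exp_neg, Real.exp_log hs0] at h
    have h' := mul_le_mul_of_nonneg_right h (div_pos hx hc).le
    have e : (a / x - (a / x)⁻¹) / 2 * (x / c) + (x - a) / c = -(a - x) ^ 2 / (2 * c * a) := by
      field_simp; ring
    linarith
end

section
/- Let I be an arbitrary index set and for each α ∈ I let X_α be a random variable with X_α ≥ 0 and 0 < E X_α < ∞, and let Y_α have the size-biased distribution of X_α. Then: (i) if the family {Y_α : α ∈ I} is tight, then the family {X_α : α ∈ I} is uniformly integrable; (ii) if moreover there exists c > 0 with E X_α ≥ c for all α ∈ I, then {X_α : α ∈ I} is uniformly integrable if and only if {Y_α : α ∈ I} is tight. -/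
open MeasureTheory

/-- A family of laws of nonnegative random variables is tight:  for all
`ε > 0` there is `L < ∞` with `P(Yα > L) < ε` for all `α`. -/
def TightFam {ι : Type*} (ν : ι → Measure ℝ) : Prop :=
  ∀ ε : ℝ, 0 < ε → ∃ L : ℝ, ∀ α, ν α {x | L < x} < ENNReal.ofReal ε

/-- A family of laws of nonnegative random variables is uniformly integrable:
for all `δ > 0` there is `L < ∞` with `E(Xα ; Xα > L) < δ` for all `α`. -/
def UIFam {ι : Type*} (μ : ι → Measure ℝ) : Prop :=
  ∀ δ : ℝ, 0 < δ →
    ∃ L : ℝ, ∀ α, (∫⁻ x in {y | L < y}, ENNReal.ofReal x ∂(μ α)) < ENNReal.ofReal δ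

/-- The tail expectation is the mean times the tail of the size-biased law. -/
theorem tail_eq (μ : Measure ℝ) (hpos : 0 < ∫ x, x ∂μ) (L : ℝ) :
    (∫⁻ x in {y | L < y}, ENNReal.ofReal x ∂μ)
      = ENNReal.ofReal (∫ x, x ∂μ) * sizeBiasedLaw μ {x | L < x} := by
  have hm : MeasurableSet {y : ℝ | L < y} := measurableSet_Ioi
  rw [sizeBiasedLaw, withDensity_apply _ hm, ← lintegral_const_mul _ (by fun_prop)]
  congr 1
  ext x
  have hne := hpos.ne'
  rw [← ENNReal.ofReal_mul hpos.le, mul_div_cancel₀ _ hne]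

/-- If the size-biased tail at `L` is below `1/2`, the mean is at most `2 * max L 0`. -/
theorem mean_le (μ : Measure ℝ) [IsProbabilityMeasure μ] (hnonneg : μ {x | x < 0} = 0)
    (hInt : Integrable (fun x => x) μ) (hpos : 0 < ∫ x, x ∂μ) (L : ℝ)
    (hL : sizeBiasedLaw μ {x | L < x} < ENNReal.ofReal (1 / 2)) :
    ∫ x, x ∂μ ≤ 2 * max L 0 := by
  have hm : MeasurableSet {y : ℝ | L < y} := measurableSet_Ioi
  have h0 : 0 ≤ᵐ[μ] (fun x : ℝ => x) := by
    rw [Filter.EventuallyLE, ae_iff]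
    simpa using hnonneg
  have h1 := ofReal_integral_eq_lintegral_ofReal hInt h0
  rw [← lintegral_add_compl _ hm, tail_eq μ hpos L] at h1
  have h2 : (∫⁻ x in {y | L < y}ᶜ, ENNReal.ofReal x ∂μ) ≤ ENNReal.ofReal (max L 0) := by
    calc _ ≤ ∫⁻ x in {y | L < y}ᶜ, ENNReal.ofReal (max L 0) ∂μ := by
          refine setLIntegral_mono' hm.compl fun x hx => ENNReal.ofReal_le_ofReal ?_
          exact le_max_of_le_left (not_lt.mp hx)
      _ = ENNReal.ofReal (max L 0) * μ {y | L < y}ᶜ := by simp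
      _ ≤ ENNReal.ofReal (max L 0) * 1 := by gcongr; exact prob_le_one
      _ = _ := mul_one _
  have h3 : ENNReal.ofReal (∫ x, x ∂μ)
      ≤ ENNReal.ofReal ((∫ x, x ∂μ) * (1 / 2) + max L 0) := by
    rw [ENNReal.ofReal_add (by positivity) (le_max_right _ _), ENNReal.ofReal_mul hpos.le]
    calc _ = _ := h1
      _ ≤ _ := add_le_add (mul_le_mul_right hL.le _) h2
  have h4 := (ENNReal.ofReal_le_ofReal_iff
    (add_nonneg (by positivity) (le_max_right L 0))).mp h3
  linarith

/-- Size bias connects uniform integrability and tightness.  Let `Xα ≥ 0`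
with `0 < E Xα < ∞` for each `α` in an arbitrary index set, and let `Yα` have
the size-biased distribution of `Xα`.  Then (i) if `{Yα}` is tight then
`{Xα}` is uniformly integrable; (ii) if moreover the means `E Xα` are bounded
away from `0`, then `{Xα}` is UI iff `{Yα}` is tight. -/
theorem stmt14 {ι : Type*} (μ : ι → Measure ℝ)
    (hprob : ∀ α, IsProbabilityMeasure (μ α))
    (hnonneg : ∀ α, μ α {x | x < 0} = 0)
    (hInt : ∀ α, Integrable (fun x => x) (μ α))
    (hpos : ∀ α, 0 < ∫ x, x ∂(μ α))
    (ν : ι → Measure ℝ) (hν : ∀ α, ν α = sizeBiasedLaw (μ α)) :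
    (TightFam ν → UIFam μ) ∧
    (∀ c : ℝ, 0 < c → (∀ α, c ≤ ∫ x, x ∂(μ α)) → (UIFam μ ↔ TightFam ν)) := by
  obtain rfl : ν = fun α => sizeBiasedLaw (μ α) := funext hν
  have main : TightFam (fun α => sizeBiasedLaw (μ α)) → UIFam μ := by
    intro hT δ hδ
    obtain ⟨L₀, hL₀⟩ := hT (1 / 2) (by norm_num)
    have hM : 0 < 2 * max L₀ 0 + 1 := by
      have := le_max_right L₀ 0
      linarith
    obtain ⟨L, hL⟩ := hT (δ / (2 * max L₀ 0 + 1)) (by positivity)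
    refine ⟨L, fun α => ?_⟩
    have := hprob α
    have hle := mean_le (μ α) (hnonneg α) (hInt α) (hpos α) L₀ (hL₀ α)
    rw [tail_eq (μ α) (hpos α) L]
    calc _ < ENNReal.ofReal (∫ x, x ∂(μ α)) * ENNReal.ofReal (δ / (2 * max L₀ 0 + 1)) :=
          ENNReal.mul_lt_mul_right (ENNReal.ofReal_pos.mpr (hpos α)).ne'
            ENNReal.ofReal_ne_top (hL α)
      _ ≤ ENNReal.ofReal (2 * max L₀ 0 + 1) * ENNReal.ofReal (δ / (2 * max L₀ 0 + 1)) := by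
          gcongr
          linarith
      _ = ENNReal.ofReal δ := by
          rw [← ENNReal.ofReal_mul hM.le, mul_div_cancel₀ _ hM.ne']
  refine ⟨main, fun c hc hca => ⟨fun hU ε hε => ?_, main⟩⟩
  obtain ⟨L, hL⟩ := hU (c * ε) (by positivity)
  refine ⟨L, fun α => ?_⟩
  have h := hL α
  rw [tail_eq (μ α) (hpos α) L, ENNReal.ofReal_mul hc.le] at h
  by_contra hcon
  exact absurd h (not_lt.mpr (mul_le_mul' (ENNReal.ofReal_le_ofReal (hca α)) (not_lt.mp hcon)))
end

section
/- Let I be an arbitrary index set and for each α ∈ I let X_α be a random variable with X_α ≥ 0 and E X_α < ∞. Fix any c ∈ (0,∞) and for each α let Y_α have the size-biased distribution of c + X_α. Then the family {X_α : α ∈ I} is uniformly integrable if and only if the family {Y_α : α ∈ I} is tight. -/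
open MeasureTheory

/-- The mean of `c + X`, and the tails of its size-biased law. -/
theorem key_facts (μ : Measure ℝ) [IsProbabilityMeasure μ] (hn : μ {x | x < 0} = 0)
    (hI : Integrable (fun x => x) μ) (c : ℝ) (hc : 0 < c) :
    ∃ A : ℝ, c ≤ A ∧ (∫⁻ x, ENNReal.ofReal (c + x) ∂μ) = ENNReal.ofReal A ∧
      ∀ L : ℝ, ENNReal.ofReal A * sizeBiasedLaw (Measure.map (fun x => c + x) μ) {x | L < x}
        = ∫⁻ x in {x | L - c < x}, ENNReal.ofReal (c + x) ∂μ := by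
  have hae : ∀ᵐ x ∂μ, 0 ≤ x := by
    rw [ae_iff]; simpa using hn
  have hm : 0 ≤ ∫ x, x ∂μ := integral_nonneg_of_ae hae
  have hI2 : Integrable (fun x => c + x) μ := (integrable_const c).add hI
  have hA : ∫ x, (c + x) ∂μ = c + ∫ x, x ∂μ := by
    rw [integral_add (integrable_const c) hI]; simp
  have hmeas : Measurable (fun x : ℝ => c + x) := by fun_prop
  refine ⟨∫ x, (c + x) ∂μ, by linarith, ?_, ?_⟩
  · rw [ofReal_integral_eq_lintegral_ofReal hI2]
    filter_upwards [hae] with x hx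
    show (0 : ℝ) ≤ c + x
    linarith
  · intro L
    have hmap : ∫ y, y ∂(Measure.map (fun x => c + x) μ) = ∫ x, (c + x) ∂μ :=
      integral_map hmeas.aemeasurable (by fun_prop)
    have hpos : 0 < ∫ x, (c + x) ∂μ := by linarith
    have hS : MeasurableSet {x : ℝ | L < x} := measurableSet_Ioi
    rw [sizeBiasedLaw, hmap]
    generalize (∫ x, (c + x) ∂μ) = A at hpos
    rw [withDensity_apply _ hS, setLIntegral_map hS (by fun_prop) hmeas,
      ← lintegral_const_mul _ (by fun_prop)]
    have hset : (fun x : ℝ => c + x) ⁻¹' {x | L < x} = {x | L - c < x} := by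
      ext x; simp [sub_lt_iff_lt_add']
    rw [hset]
    refine lintegral_congr fun x => ?_
    rw [← ENNReal.ofReal_mul hpos.le]
    congr 1
    field_simp

/-- Let `Xα ≥ 0` with `E Xα < ∞` for each `α` in an arbitrary index set, fix
`c ∈ (0,∞)`, and let `Yα` have the size-biased distribution of `c + Xα`.
Then `{Xα}` is uniformly integrable iff `{Yα}` is tight. -/
theorem stmt15 {ι : Type*} (μ : ι → Measure ℝ)
    (hprob : ∀ α, IsProbabilityMeasure (μ α))
    (hnonneg : ∀ α, μ α {x | x < 0} = 0)
    (hInt : ∀ α, Integrable (fun x => x) (μ α))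
    (c : ℝ) (hc : 0 < c)
    (ν : ι → Measure ℝ)
    (hν : ∀ α, ν α = sizeBiasedLaw (Measure.map (fun x => c + x) (μ α))) :
    UIFam μ ↔ TightFam ν := by
  constructor
  · intro hU ε hε
    obtain ⟨L, hL⟩ := hU (c * ε / 2) (by positivity)
    refine ⟨max L c + c, fun α => ?_⟩
    haveI := hprob α
    obtain ⟨A, hcA, -, hK⟩ := key_facts (μ α) (hnonneg α) (hInt α) c hc
    have hA : 0 < A := hc.trans_le hcA
    have h0 : ENNReal.ofReal A ≠ 0 := by simpa using hA
    rw [hν α, ← ENNReal.mul_lt_mul_iff_right h0 ENNReal.ofReal_ne_top, hK, add_sub_cancel_right]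
    calc ∫⁻ x in {x | max L c < x}, ENNReal.ofReal (c + x) ∂(μ α)
        ≤ ∫⁻ x in {x | max L c < x}, ENNReal.ofReal 2 * ENNReal.ofReal x ∂(μ α) := by
          refine setLIntegral_mono (by fun_prop) fun x hx => ?_
          have hx' : c < x := lt_of_le_of_lt (le_max_right _ _) hx
          rw [← ENNReal.ofReal_mul (by norm_num)]
          exact ENNReal.ofReal_le_ofReal (by linarith)
      _ = ENNReal.ofReal 2 * ∫⁻ x in {x | max L c < x}, ENNReal.ofReal x ∂(μ α) :=
          lintegral_const_mul _ (by fun_prop)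
      _ ≤ ENNReal.ofReal 2 * ∫⁻ x in {x | L < x}, ENNReal.ofReal x ∂(μ α) := by
          gcongr
          exact le_max_left _ _
      _ < ENNReal.ofReal 2 * ENNReal.ofReal (c * ε / 2) := by
          rw [ENNReal.mul_lt_mul_iff_right (by simp) ENNReal.ofReal_ne_top]
          exact hL α
      _ ≤ ENNReal.ofReal A * ENNReal.ofReal ε := by
          rw [← ENNReal.ofReal_mul (by norm_num), ← ENNReal.ofReal_mul hA.le]
          apply ENNReal.ofReal_le_ofReal
          nlinarith
  · intro hT δ hδ
    obtain ⟨L0, hL0⟩ := hT (1 / 2) (by norm_num)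
    have hM : 0 ≤ max L0 0 := le_max_right _ _
    obtain ⟨L, hL⟩ := hT (δ / (2 * max L0 0 + 1)) (by positivity)
    refine ⟨L - c, fun α => ?_⟩
    haveI := hprob α
    obtain ⟨A, hcA, hT', hK⟩ := key_facts (μ α) (hnonneg α) (hInt α) c hc
    have hA : 0 < A := hc.trans_le hcA
    have h0 : ENNReal.ofReal A ≠ 0 := by simpa using hA
    have hS : MeasurableSet {x : ℝ | L0 - c < x} := measurableSet_Ioi
    have hbound : A ≤ 2 * max L0 0 := by
      have h1 : ENNReal.ofReal A ≤ ENNReal.ofReal (A * (1 / 2) + max L0 0) := by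
        rw [ENNReal.ofReal_add (by positivity) hM, ENNReal.ofReal_mul hA.le]
        conv_lhs => rw [← hT', ← lintegral_add_compl _ hS]
        refine add_le_add ?_ ?_
        · rw [← hK, ← hν α]
          gcongr
          exact (hL0 α).le
        · calc ∫⁻ x in {x | L0 - c < x}ᶜ, ENNReal.ofReal (c + x) ∂(μ α)
              ≤ ∫⁻ x in {x | L0 - c < x}ᶜ, ENNReal.ofReal (max L0 0) ∂(μ α) := by
                refine setLIntegral_mono (by fun_prop) fun x hx => ?_
                have hx' : x ≤ L0 - c := not_lt.mp hx
                have := le_max_left L0 0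
                exact ENNReal.ofReal_le_ofReal (by linarith)
            _ ≤ ENNReal.ofReal (max L0 0) := by
                rw [setLIntegral_const]
                exact mul_le_of_le_one_right' prob_le_one
      have h2 := (ENNReal.ofReal_le_ofReal_iff (by positivity)).1 h1
      linarith
    calc ∫⁻ x in {x | L - c < x}, ENNReal.ofReal x ∂(μ α)
        ≤ ∫⁻ x in {x | L - c < x}, ENNReal.ofReal (c + x) ∂(μ α) := by
          refine lintegral_mono fun x => ENNReal.ofReal_le_ofReal (by linarith)
      _ = ENNReal.ofReal A * ν α {x | L < x} := by rw [hν α, hK]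
      _ < ENNReal.ofReal A * ENNReal.ofReal (δ / (2 * max L0 0 + 1)) := by
          rw [ENNReal.mul_lt_mul_iff_right h0 ENNReal.ofReal_ne_top]
          exact hL α
      _ ≤ ENNReal.ofReal δ := by
          rw [← ENNReal.ofReal_mul hA.le]
          apply ENNReal.ofReal_le_ofReal
          rw [mul_div_assoc', div_le_iff₀ (by positivity)]
          nlinarith
end

section
/- Fix σ > 0 and set c := exp(σ²). For any b ∈ (0,∞), there is a probability distribution for a discrete random variable X_{b,c} supported on the single orbit {b c^n : n ∈ ℤ}, with probability mass function P(X_{b,c} = b c^n) = b^{−n} c^{−n²/2} / t(b,c), where t(b,c) = Σ_{m ∈ ℤ} b^{−m} c^{−m²/2}. This random variable satisfies E X_{b,c} = √c and X_{b,c}* =^d c X_{b,c}, and consequently E (X_{b,c})^n = exp(n² σ²/2) for all n ∈ ℤ; in particular, for nonnegative integers n, X_{b,c} has the same moments as the lognormal exp(σZ), where Z is standard normal. -/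
open MeasureTheory ProbabilityTheory

lemma exp_zpow_aux (x : ℝ) (n : ℤ) : Real.exp x ^ n = Real.exp (n * x) := by
  rw [mul_comm, Real.exp_mul, Real.rpow_intCast]

noncomputable def wgt (σ b : ℝ) (n : ℤ) : ℝ :=
  b ^ (-n) * Real.exp (-(n : ℝ) ^ 2 * σ ^ 2 / 2)

noncomputable def pt (σ b : ℝ) (n : ℤ) : ℝ := b * Real.exp (σ ^ 2) ^ n

noncomputable def prb (σ b : ℝ) (n : ℤ) : ℝ := wgt σ b n / ∑' m : ℤ, wgt σ b m

noncomputable def clLaw (σ b : ℝ) : Measure ℝ :=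
  Measure.sum fun n : ℤ => ENNReal.ofReal (prb σ b n) • Measure.dirac (pt σ b n)

lemma pt_pos (σ : ℝ) {b : ℝ} (hb : 0 < b) (n : ℤ) : 0 < pt σ b n := by
  unfold pt; positivity

lemma wgt_pos (σ : ℝ) {b : ℝ} (hb : 0 < b) (n : ℤ) : 0 < wgt σ b n := by
  unfold wgt; positivity

lemma wgt_mul (σ : ℝ) {b : ℝ} (hb : 0 < b) (n k : ℤ) :
    wgt σ b n * pt σ b n ^ k = wgt σ b (n - k) * Real.exp ((k : ℝ) ^ 2 * σ ^ 2 / 2) := by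
  obtain ⟨β, rfl⟩ : ∃ β, b = Real.exp β := ⟨Real.log b, (Real.exp_log hb).symm⟩
  unfold wgt pt
  simp only [exp_zpow_aux, ← Real.exp_add]
  congr 1
  push_cast
  ring

lemma wgt_summable {σ b : ℝ} (hσ : 0 < σ) (hb : 0 < b) : Summable (wgt σ b) := by
  have h := (summable_jacobiTheta₂_term_iff (Complex.I * (Real.log b / (2 * Real.pi) : ℝ))
    (Complex.I * (σ ^ 2 / (2 * Real.pi) : ℝ))).2 (by
      rw [Complex.I_mul_im, Complex.ofReal_re]; positivity)
  refine h.norm.congr fun n => ?_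
  rw [norm_jacobiTheta₂_term, Complex.I_mul_im, Complex.ofReal_re, Complex.I_mul_im,
    Complex.ofReal_re]
  unfold wgt
  conv_rhs => rw [← Real.exp_log hb]
  rw [exp_zpow_aux, ← Real.exp_add]
  congr 1
  have := Real.pi_ne_zero
  push_cast
  field_simp
  ring

lemma tot_pos {σ b : ℝ} (hσ : 0 < σ) (hb : 0 < b) : 0 < ∑' m : ℤ, wgt σ b m :=
  (wgt_summable hσ hb).tsum_pos (fun n => (wgt_pos σ hb n).le) 0 (wgt_pos σ hb 0)

lemma prb_nonneg {σ b : ℝ} (hσ : 0 < σ) (hb : 0 < b) (n : ℤ) : 0 ≤ prb σ b n :=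
  div_nonneg (wgt_pos σ hb n).le (tot_pos hσ hb).le

lemma prb_mul {σ b : ℝ} (hb : 0 < b) (n k : ℤ) :
    prb σ b n * pt σ b n ^ k = prb σ b (n - k) * Real.exp ((k : ℝ) ^ 2 * σ ^ 2 / 2) := by
  unfold prb
  rw [div_mul_eq_mul_div, wgt_mul σ hb, div_mul_eq_mul_div]

lemma tsum_prb {σ b : ℝ} (hσ : 0 < σ) (hb : 0 < b) :
    ∑' n : ℤ, ENNReal.ofReal (prb σ b n) = 1 := by
  rw [← ENNReal.ofReal_tsum_of_nonneg (prb_nonneg hσ hb) ((wgt_summable hσ hb).div_const _)]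
  unfold prb
  rw [tsum_div_const, div_self (tot_pos hσ hb).ne', ENNReal.ofReal_one]

lemma lintegral_cl (σ b : ℝ) (f : ℝ → ENNReal) :
    ∫⁻ x, f x ∂(clLaw σ b) = ∑' n : ℤ, ENNReal.ofReal (prb σ b n) * f (pt σ b n) := by
  unfold clLaw
  rw [lintegral_sum_measure]
  simp [lintegral_smul_measure]

lemma cl_apply (σ b : ℝ) {s : Set ℝ} (hs : MeasurableSet s) :
    clLaw σ b s = ∑' n : ℤ, ENNReal.ofReal (prb σ b n) * s.indicator 1 (pt σ b n) := by
  rw [← lintegral_cl, lintegral_indicator_one hs]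

lemma cl_support (σ b : ℝ) : clLaw σ b {x : ℝ | ¬∃ n : ℤ, x = pt σ b n} = 0 := by
  have hm : MeasurableSet {x : ℝ | ¬∃ n : ℤ, x = pt σ b n} := by
    have : {x : ℝ | ¬∃ n : ℤ, x = pt σ b n} = (Set.range (pt σ b))ᶜ := by
      ext x; simp [eq_comm]
    rw [this]
    exact (Set.countable_range _).measurableSet.compl
  rw [cl_apply σ b hm, ENNReal.tsum_eq_zero]
  intro n
  simp

lemma pt_inj {σ b : ℝ} (hσ : 0 < σ) (hb : 0 < b) : Function.Injective (pt σ b) := by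
  intro m n h
  have h1 := mul_left_cancel₀ hb.ne' h
  exact zpow_right_injective₀ (Real.exp_pos _) (by
    have : 0 < σ ^ 2 := by positivity
    exact (Real.one_lt_exp_iff.2 this).ne') h1

lemma cl_moment {σ b : ℝ} (hσ : 0 < σ) (hb : 0 < b) (k : ℤ) :
    (∫ x, x ^ k ∂(clLaw σ b)) = Real.exp ((k : ℝ) ^ 2 * σ ^ 2 / 2) := by
  have hae : ∀ᵐ x ∂(clLaw σ b), ∃ n : ℤ, x = pt σ b n := cl_support σ b
  rw [integral_eq_lintegral_of_nonneg_ae]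
  · rw [lintegral_cl]
    have : ∀ n : ℤ, ENNReal.ofReal (prb σ b n) * ENNReal.ofReal (pt σ b n ^ k) =
        ENNReal.ofReal (prb σ b (n - k)) *
          ENNReal.ofReal (Real.exp ((k : ℝ) ^ 2 * σ ^ 2 / 2)) := by
      intro n
      rw [← ENNReal.ofReal_mul (prb_nonneg hσ hb _), prb_mul hb,
        ENNReal.ofReal_mul (prb_nonneg hσ hb _)]
    simp only [this]
    have hsh : ∑' n : ℤ, ENNReal.ofReal (prb σ b (n - k)) = 1 :=
      ((Equiv.subRight k).tsum_eq (fun n => ENNReal.ofReal (prb σ b n))).trans (tsum_prb hσ hb)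
    rw [ENNReal.tsum_mul_right, hsh, one_mul,
      ENNReal.toReal_ofReal (Real.exp_pos _).le]
  · filter_upwards [hae] with x hx
    obtain ⟨n, rfl⟩ := hx
    exact (zpow_pos (pt_pos σ hb n) k).le
  · exact (measurable_id.pow_const k).aestronglyMeasurable

lemma cl_mean {σ b : ℝ} (hσ : 0 < σ) (hb : 0 < b) :
    (∫ x, x ∂(clLaw σ b)) = Real.exp (σ ^ 2 / 2) := by
  have := cl_moment hσ hb 1
  simpa using this

lemma cl_bias {σ b : ℝ} (hσ : 0 < σ) (hb : 0 < b) :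
    sizeBiasedLaw (clLaw σ b) = Measure.map (fun x => Real.exp (σ ^ 2) * x) (clLaw σ b) := by
  have hf : Measurable fun x : ℝ => Real.exp (σ ^ 2) * x := by fun_prop
  ext s hs
  unfold sizeBiasedLaw
  rw [cl_mean hσ hb, withDensity_apply _ hs, ← lintegral_indicator hs, lintegral_cl,
    Measure.map_apply hf hs, cl_apply _ _ (hf hs)]
  refine Eq.trans ?_ ((Equiv.subRight (1 : ℤ)).tsum_eq _)
  refine tsum_congr fun n => ?_
  have hp : Real.exp (σ ^ 2) * pt σ b (n - 1) = pt σ b n := by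
    unfold pt
    rw [zpow_sub_one₀ (Real.exp_pos _).ne']
    field_simp
  have hq : prb σ b n * (pt σ b n / Real.exp (σ ^ 2 / 2)) = prb σ b (n - 1) := by
    have := prb_mul (σ := σ) hb n 1
    simp only [zpow_one, Int.cast_one, one_pow, one_mul] at this
    rw [← mul_div_assoc, this, mul_div_cancel_right₀ _ (Real.exp_pos _).ne']
  simp only [Equiv.subRight_apply]
  by_cases h : pt σ b n ∈ s
  · rw [Set.indicator_of_mem h, Set.indicator_of_mem (by simpa [hp] using h),
      ← ENNReal.ofReal_mul (prb_nonneg hσ hb _), hq]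
    simp
  · rw [Set.indicator_of_notMem h, Set.indicator_of_notMem (by simpa [hp] using h)]
    simp

/-- The Chihara–Leipnik single-orbit discrete distributions.  Fix `σ > 0`,
`c := exp(σ²)`, and `b ∈ (0,∞)`.  There is a probability distribution `μ`
supported on the orbit `{b cⁿ : n ∈ ℤ}`, with
`μ {b cⁿ} = b⁻ⁿ c^{-n²/2} / t(b,c)` where
`t(b,c) = ∑_{m ∈ ℤ} b⁻ᵐ c^{-m²/2}` (here `c^{-n²/2} = exp(-n²σ²/2)`),
satisfying `E X = √c` and `X* =ᵈ cX`; consequently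
`E Xⁿ = exp(n²σ²/2)` for all `n ∈ ℤ`, so in particular for nonnegative
integers `n` it has the same moments as the lognormal `exp(σZ)` with `Z`
standard normal. -/
theorem stmt17 (σ : ℝ) (hσ : 0 < σ) (b : ℝ) (hb : 0 < b) :
    ∃ μ : Measure ℝ, IsProbabilityMeasure μ ∧
      -- supported on the single orbit `{b cⁿ : n ∈ ℤ}`
      μ {x : ℝ | ¬∃ n : ℤ, x = b * Real.exp (σ ^ 2) ^ n} = 0 ∧
      -- with the stated point masses
      (∀ n : ℤ, μ {b * Real.exp (σ ^ 2) ^ n} =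
        ENNReal.ofReal ((b ^ (-n) * Real.exp (-(n : ℝ) ^ 2 * σ ^ 2 / 2)) /
          (∑' m : ℤ, b ^ (-m) * Real.exp (-(m : ℝ) ^ 2 * σ ^ 2 / 2)))) ∧
      -- mean `√c`
      (∫ x, x ∂μ) = Real.sqrt (Real.exp (σ ^ 2)) ∧
      -- `X* =ᵈ cX`
      sizeBiasedLaw μ = Measure.map (fun x => Real.exp (σ ^ 2) * x) μ ∧
      -- all integer moments agree with those of the lognormal
      (∀ n : ℤ, (∫ x, x ^ n ∂μ) = Real.exp ((n : ℝ) ^ 2 * σ ^ 2 / 2)) ∧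
      -- in particular, same (nonnegative integer) moments as `exp(σ Z)`
      (∀ n : ℕ, (∫ x, x ^ n ∂μ) =
        ∫ z, Real.exp (σ * z) ^ n ∂(gaussianReal 0 1)) := by
  refine ⟨clLaw σ b, ⟨?_⟩, cl_support σ b, ?_, ?_, cl_bias hσ hb, cl_moment hσ hb, ?_⟩
  · rw [cl_apply _ _ MeasurableSet.univ]
    simpa using tsum_prb hσ hb
  · intro n
    change clLaw σ b {pt σ b n} = ENNReal.ofReal (prb σ b n)
    rw [cl_apply _ _ (measurableSet_singleton _), tsum_eq_single n]
    · simp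
    · intro m hm
      have : pt σ b m ≠ pt σ b n := fun h => hm (pt_inj hσ hb h)
      simp [this]
  · rw [cl_mean hσ hb, Real.exp_half]
  · intro n
    have h1 := cl_moment hσ hb n
    simp only [zpow_natCast, Int.cast_natCast] at h1
    have h2 := congrFun (mgf_id_gaussianReal (μ := 0) (v := 1)) (n * σ)
    simp only [mgf, id] at h2
    rw [h1]
    simp only [← Real.exp_nat_mul, ← mul_assoc]
    rw [h2]
    congr 1
    push_cast
    ring
end

section
/- Fix c > 1, and let X and Y be strictly positive random variables satisfying 0 < E X = E Y < ∞, X* =^d cX, and Y* =^d cY. If there exists a constant k ≥ 0 such that P(X ∈ A) = k·P(Y ∈ A) for all measurable subsets A of the interval [1, c), then X =^d Y (and necessarily k = 1). -/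
open MeasureTheory

/-- Agreement on `S` passes to `c⁻¹ S`. -/
lemma agree_down (c : ℝ) (hc : 1 < c) (w : ℝ → ENNReal) (μ ν : Measure ℝ)
    (hμ : μ.withDensity w = Measure.map (fun x => c * x) μ)
    (hν : ν.withDensity w = Measure.map (fun x => c * x) ν)
    (S : Set ℝ) (hS : MeasurableSet S) (h : μ.restrict S = ν.restrict S) :
    μ.restrict ((fun x => c * x) ⁻¹' S) = ν.restrict ((fun x => c * x) ⁻¹' S) := by
  have hf : MeasurableEmbedding (fun x : ℝ => c * x) :=
    measurableEmbedding_mulLeft₀ (by positivity)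
  have e : (Measure.map (fun x => c * x) μ).restrict S
      = (Measure.map (fun x => c * x) ν).restrict S := by
    rw [← hμ, ← hν, restrict_withDensity hS, restrict_withDensity hS, h]
  rw [Measure.restrict_map hf.measurable hS, Measure.restrict_map hf.measurable hS] at e
  rw [← hf.comap_map (μ.restrict _), e, hf.comap_map]

/-- Agreement on `c⁻¹ S` passes to `S`. -/
lemma agree_up (c : ℝ) (w : ℝ → ENNReal) (hw : Measurable w) (μ ν : Measure ℝ)
    (hμ : μ.withDensity w = Measure.map (fun x => c * x) μ)
    (hν : ν.withDensity w = Measure.map (fun x => c * x) ν)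
    (S : Set ℝ) (hS : MeasurableSet S) (h0 : ∀ x ∈ S, w x ≠ 0) (ht : ∀ x ∈ S, w x ≠ ⊤)
    (h : μ.restrict ((fun x => c * x) ⁻¹' S) = ν.restrict ((fun x => c * x) ⁻¹' S)) :
    μ.restrict S = ν.restrict S := by
  have hf : Measurable (fun x : ℝ => c * x) := by fun_prop
  have e : (μ.withDensity w).restrict S = (ν.withDensity w).restrict S := by
    rw [hμ, hν, Measure.restrict_map hf hS, Measure.restrict_map hf hS, h]
  rw [restrict_withDensity hS, restrict_withDensity hS] at e
  rw [← withDensity_inv_same hw (μ := μ.restrict S) (ae_restrict_of_forall_mem hS h0)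
    (ae_restrict_of_forall_mem hS ht), e]
  exact withDensity_inv_same hw (ae_restrict_of_forall_mem hS h0)
    (ae_restrict_of_forall_mem hS ht)

/-- Fix `c > 1` and let `X, Y` be strictly positive random variables with
`0 < E X = E Y < ∞`, `X* =ᵈ cX` and `Y* =ᵈ cY`.  If the laws of `X` and `Y`
restricted to `[1, c)` agree up to a constant mass factor `k ≥ 0`, then
`X =ᵈ Y` (and necessarily `k = 1`). -/
theorem stmt18 (c : ℝ) (hc : 1 < c)
    (μX μY : Measure ℝ) [IsProbabilityMeasure μX] [IsProbabilityMeasure μY]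
    (hXpos : μX {x | x ≤ 0} = 0) (hYpos : μY {x | x ≤ 0} = 0)
    (hXInt : Integrable (fun x => x) μX) (hYInt : Integrable (fun x => x) μY)
    (hmean : (∫ x, x ∂μX) = ∫ x, x ∂μY) (hmeanpos : 0 < ∫ x, x ∂μX)
    (hX : sizeBiasedLaw μX = Measure.map (fun x => c * x) μX)
    (hY : sizeBiasedLaw μY = Measure.map (fun x => c * x) μY)
    (k : ℝ) (hk : 0 ≤ k)
    (hagree : ∀ A : Set ℝ, MeasurableSet A → A ⊆ Set.Ico 1 c →
      μX A = ENNReal.ofReal k * μY A) :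
    μX = μY ∧ k = 1 := by
  have hc0 : 0 < c := by linarith
  set a := ∫ x, x ∂μX with ha
  set w : ℝ → ENNReal := fun x => ENNReal.ofReal (x / a) with hwdef
  have hw : Measurable w := by fun_prop
  set ν : Measure ℝ := ENNReal.ofReal k • μY with hνdef
  have hμ' : μX.withDensity w = Measure.map (fun x => c * x) μX := hX
  have hν' : ν.withDensity w = Measure.map (fun x => c * x) ν := by
    have hY' : μY.withDensity w = Measure.map (fun x => c * x) μY := by
      rw [← hY, sizeBiasedLaw, ← hmean]
    rw [hνdef, withDensity_smul_measure, Measure.map_smul, hY']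
  have hpre : ∀ n : ℤ, (fun x => c * x) ⁻¹' (Set.Ico (c ^ (n + 1)) (c ^ (n + 1 + 1)))
      = Set.Ico (c ^ n) (c ^ (n + 1)) := by
    intro n
    ext x
    simp only [Set.mem_preimage, Set.mem_Ico]
    rw [zpow_add_one₀ hc0.ne' (n + 1), mul_comm c x, mul_lt_mul_iff_left₀ hc0,
      zpow_add_one₀ hc0.ne' n, mul_le_mul_iff_left₀ hc0]
  have hall : ∀ n : ℤ, μX.restrict (Set.Ico (c ^ n) (c ^ (n + 1)))
      = ν.restrict (Set.Ico (c ^ n) (c ^ (n + 1))) := by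
    intro n
    induction n using Int.induction_on with
    | zero =>
      ext A hA
      rw [Measure.restrict_apply hA, Measure.restrict_apply hA]
      have := hagree (A ∩ Set.Ico 1 c) (hA.inter measurableSet_Ico) Set.inter_subset_right
      simpa [hνdef] using this
    | succ i ih =>
      refine agree_up c w hw μX ν hμ' hν' _ measurableSet_Ico ?_ ?_ ?_
      · intro x hx
        have : 0 < x := lt_of_lt_of_le (by positivity) hx.1
        have : 0 < x / a := by positivity
        simpa [hwdef] using this
      · intro x hx
        exact ENNReal.ofReal_ne_top
      · rw [hpre]; exact ih
    | pred i ih =>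
      have := agree_down c hc w μX ν hμ' hν' _ measurableSet_Ico ih
      have h2 := hpre (-(i : ℤ) - 1)
      rw [sub_add_cancel] at h2
      rw [h2] at this
      rw [sub_add_cancel]
      exact this
  have hU : (⋃ n : ℤ, Set.Ico (c ^ n) (c ^ (n + 1))) = {x : ℝ | x ≤ 0}ᶜ := by
    ext x
    simp only [Set.mem_iUnion, Set.mem_compl_iff, Set.mem_ofPred_eq, not_le]
    constructor
    · rintro ⟨n, hn⟩
      exact lt_of_lt_of_le (by positivity) hn.1
    · intro hx
      exact exists_mem_Ico_zpow hx hc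
  have hr := (Measure.restrict_iUnion_congr (s := fun n : ℤ => Set.Ico (c ^ n) (c ^ (n + 1)))).2 hall
  rw [hU] at hr
  have hνpos : ν {x | x ≤ 0} = 0 := by simp [hνdef, hYpos]
  rw [Measure.restrict_eq_self_of_ae_mem (s := {x : ℝ | x ≤ 0}ᶜ) (compl_mem_ae_iff.2 hXpos),
    Measure.restrict_eq_self_of_ae_mem (s := {x : ℝ | x ≤ 0}ᶜ) (compl_mem_ae_iff.2 hνpos)] at hr
  have hk1 : k = 1 := by
    have h1 : μX Set.univ = ν Set.univ := by rw [hr]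
    simp [hνdef] at h1
    exact ENNReal.ofReal_eq_one.1 h1.symm
  refine ⟨?_, hk1⟩
  rw [hr, hνdef, hk1]
  simp
end

section
/- Let X be a nonnegative random variable with a := E X ∈ (0,∞). Then X is infinitely divisible (i.e., for each n ≥ 1 there exist i.i.d. random variables X_1^{(n)}, …, X_n^{(n)} with X =^d X_1^{(n)} + ⋯ + X_n^{(n)}) if and only if there exists a random variable Y, independent of X, such that X* =^d X + Y, where X* has the size-biased distribution of X. In either case the distribution of Y is unique, and P(Y ≥ 0) = 1. -/
open MeasureTheory

/-- The `n`-fold (additive) convolution power of a measure on `ℝ`: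
`convPow ν n = ν ∗ ⋯ ∗ ν` (`n` factors), with `convPow ν 0 = δ₀`. -/
noncomputable def convPow (ν : Measure ℝ) : ℕ → Measure ℝ
  | 0 => Measure.dirac 0
  | n + 1 => (convPow ν n).conv ν

theorem sb_prob (μ : Measure ℝ) [IsProbabilityMeasure μ]
    (hpos : μ {x | x < 0} = 0) (hInt : Integrable (fun x => x) μ)
    (hmean : 0 < ∫ x, x ∂μ) : IsProbabilityMeasure (sizeBiasedLaw μ) := by
  have hae : ∀ᵐ x ∂μ, 0 ≤ x := by
    rw [ae_iff]; simpa using hpos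
  constructor
  rw [sizeBiasedLaw, withDensity_apply _ MeasurableSet.univ, Measure.restrict_univ,
    ← ofReal_integral_eq_lintegral_ofReal (hInt.div_const _), integral_div, div_self hmean.ne',
    ENNReal.ofReal_one]
  filter_upwards [hae] with x hx using div_nonneg hx hmean.le

theorem sb_charFun (μ : Measure ℝ) [IsProbabilityMeasure μ]
    (hpos : μ {x | x < 0} = 0)
    (hmean : 0 < ∫ x, x ∂μ) (t : ℝ) :
    (∫ x, x ∂μ : ℝ) * charFun (sizeBiasedLaw μ) t
      = ∫ x : ℝ, (x : ℂ) * Complex.exp (t * x * Complex.I) ∂μ := by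
  have hae : ∀ᵐ x ∂μ, 0 ≤ x := by
    rw [ae_iff]; simpa using hpos
  rw [charFun_apply_real, sizeBiasedLaw, integral_withDensity_eq_integral_toReal_smul
    (by fun_prop) (by simp), ← integral_const_mul]
  apply integral_congr_ae
  filter_upwards [hae] with x hx
  rw [ENNReal.toReal_ofReal (div_nonneg hx hmean.le), Complex.real_smul]
  have : ((∫ x, x ∂μ : ℝ) : ℂ) ≠ 0 := by exact_mod_cast hmean.ne'
  rw [Complex.ofReal_div]
  field_simp

theorem hasDeriv_charFun (μ : Measure ℝ) [IsProbabilityMeasure μ]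
    (hpos : μ {x | x < 0} = 0) (hInt : Integrable (fun x => x) μ)
    (hmean : 0 < ∫ x, x ∂μ) (t : ℝ) :
    HasDerivAt (charFun μ)
      (Complex.I * ((∫ x, x ∂μ : ℝ) * charFun (sizeBiasedLaw μ) t)) t := by
  have hm : MemLp id (1 : ℕ) μ := by
    rw [Nat.cast_one, memLp_one_iff_integrable]; exact hInt
  have hd : DifferentiableAt ℝ (charFun μ) t :=
    (contDiff_charFun hm).differentiable (by simp) t
  have h := iteratedDeriv_charFun (t := t) hm
  rw [iteratedDeriv_one] at h
  rw [sb_charFun μ hpos hmean]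
  have := hd.hasDerivAt
  rw [h] at this
  simpa using this

instance convPow_prob (ν : Measure ℝ) [IsProbabilityMeasure ν] (n : ℕ) :
    IsProbabilityMeasure (convPow ν n) := by
  induction n with
  | zero => rw [convPow]; infer_instance
  | succ n ih => rw [convPow]; infer_instance

theorem charFun_convPow (ν : Measure ℝ) [IsProbabilityMeasure ν] (n : ℕ) (t : ℝ) :
    charFun (convPow ν n) t = charFun ν t ^ n := by
  induction n with
  | zero => rw [convPow]; simp [charFun_apply_real]
  | succ n ih => rw [convPow, charFun_conv, ih, pow_succ]

theorem conv_ge (μ ν : Measure ℝ) [IsProbabilityMeasure μ] [IsProbabilityMeasure ν]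
    {A B C : Set ℝ} (hC : MeasurableSet C) (h : ∀ x ∈ A, ∀ y ∈ B, x + y ∈ C) :
    μ A * ν B ≤ (μ.conv ν) C := by
  rw [Measure.conv, Measure.map_apply (by fun_prop) hC, ← Measure.prod_prod]
  apply measure_mono
  rintro ⟨x, y⟩ ⟨hx, hy⟩
  exact h x hx y hy

theorem convPow_neg (ν : Measure ℝ) [IsProbabilityMeasure ν] (n : ℕ) :
    ν {x | x < 0} ^ (n + 1) ≤ convPow ν (n + 1) {x | x < 0} := by
  induction n with
  | zero =>
    rw [convPow, convPow, Measure.dirac_zero_conv]; simp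
  | succ n ih =>
    rw [convPow, pow_succ]
    refine le_trans (mul_le_mul_left ih _) (conv_ge _ _ measurableSet_Iio ?_)
    intro x hx y hy
    simp only [Set.mem_ofPred_eq] at *
    linarith

theorem convPow_nonneg (ν : Measure ℝ) [IsProbabilityMeasure ν] (h : ν {x | x < 0} = 0) (n : ℕ) :
    convPow ν n {x | 0 ≤ x} = 1 := by
  induction n with
  | zero => rw [convPow]; simp
  | succ n ih =>
    rw [convPow]
    have h1 : ν {x | 0 ≤ x} = 1 := by
      refine (prob_compl_eq_zero_iff measurableSet_Ici).1 ?_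
      convert h using 2
      ext x; simp
    apply le_antisymm prob_le_one
    have := conv_ge (convPow ν n) ν (A := {x | 0 ≤ x}) (B := {x | 0 ≤ x}) (C := {x | 0 ≤ x})
      measurableSet_Ici (by
        intro x hx y hy
        simp only [Set.mem_ofPred_eq] at *
        linarith)
    rwa [ih, h1, one_mul] at this

/-- Laws `ν` with `μ* = μ ∗ ν` are nonnegative. -/
theorem nu_nonneg (μ ν : Measure ℝ) [IsProbabilityMeasure μ] [IsProbabilityMeasure ν]
    (hpos : μ {x | x < 0} = 0) (h : sizeBiasedLaw μ = μ.conv ν) : ν {x | x < 0} = 0 := by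
  by_contra hne
  obtain ⟨ε, hε, hν⟩ : ∃ ε > 0, ν {x | x < -ε} ≠ 0 := by
    by_contra hcon
    push Not at hcon
    apply hne
    have : {x : ℝ | x < 0} = ⋃ n : ℕ, {x | x < -(1 / ((n : ℝ) + 1))} := by
      ext x
      simp only [Set.mem_ofPred_eq, Set.mem_iUnion]
      constructor
      · intro hx
        obtain ⟨n, hn⟩ := exists_nat_one_div_lt (neg_pos.2 hx)
        exact ⟨n, by linarith⟩
      · rintro ⟨n, hn⟩
        have : 0 < 1 / ((n : ℝ) + 1) := by positivity
        linarith
    rw [this, measure_iUnion_null_iff]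
    intro n
    exact hcon _ (by positivity)
  have hac : sizeBiasedLaw μ ≪ μ := withDensity_absolutelyContinuous _ _
  -- if mu (Iio c) = 0 then mu (Iio (c + ε)) = 0
  have key : ∀ n : ℕ, μ {x | x < n * ε} = 0 := by
    intro n
    induction n with
    | zero => simpa using hpos
    | succ n ih =>
      have h1 := conv_ge μ ν (A := {x | x < (n + 1 : ℕ) * ε}) (B := {x | x < -ε})
        (C := {x | x < n * ε}) measurableSet_Iio (by
          intro x hx y hy
          simp only [Set.mem_ofPred_eq] at *
          push_cast at hx
          linarith)
      rw [← h, hac ih] at h1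
      have := le_antisymm h1 (zero_le)
      rcases mul_eq_zero.1 this with h2 | h2
      · exact h2
      · exact absurd h2 hν
  have : μ Set.univ = 0 := by
    have hU : (Set.univ : Set ℝ) = ⋃ n : ℕ, {x | x < n * ε} := by
      ext x
      simp only [Set.mem_univ, Set.mem_iUnion, true_iff, Set.mem_ofPred_eq]
      obtain ⟨n, hn⟩ := exists_nat_gt (x / ε)
      exact ⟨n, (div_lt_iff₀ hε).1 hn⟩
    rw [hU, measure_iUnion_null_iff]
    exact key
  simp at this

theorem charFun_exp (μ ν : Measure ℝ) [IsProbabilityMeasure μ] [IsProbabilityMeasure ν]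
    (hpos : μ {x | x < 0} = 0) (hInt : Integrable (fun x => x) μ)
    (hmean : 0 < ∫ x, x ∂μ) (h : sizeBiasedLaw μ = μ.conv ν) (t : ℝ) :
    charFun μ t = Complex.exp ((∫ x, x ∂μ : ℝ) * (Complex.I * ∫ s in (0 : ℝ)..t, charFun ν s)) := by
  set a : ℂ := ((∫ x, x ∂μ : ℝ) : ℂ) with ha
  have hF : ∀ t : ℝ, HasDerivAt (fun t : ℝ => -(a * (Complex.I * ∫ s in (0 : ℝ)..t, charFun ν s)))
      (-(a * (Complex.I * charFun ν t))) t := by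
    intro t
    have := (continuous_charFun (μ := ν)).integral_hasStrictDerivAt 0 t
    exact ((this.hasDerivAt.const_mul Complex.I).const_mul a).neg
  have hG : ∀ t : ℝ, HasDerivAt (fun t : ℝ => charFun μ t *
      Complex.exp (-(a * (Complex.I * ∫ s in (0 : ℝ)..t, charFun ν s)))) 0 t := by
    intro t
    have h1 := (hasDeriv_charFun μ hpos hInt hmean t).mul (hF t).cexp
    refine h1.congr_deriv ?_
    rw [h, charFun_conv]
    ring
  have hc := is_const_of_deriv_eq_zero (fun t => (hG t).differentiableAt)
    (fun t => (hG t).deriv) t 0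
  simp only [intervalIntegral.integral_same, mul_zero, neg_zero, Complex.exp_zero, charFun_zero,
    probReal_univ, Complex.ofReal_one, mul_one] at hc
  rw [Complex.exp_neg, mul_inv_eq_one₀ (Complex.exp_ne_zero _)] at hc
  exact hc

theorem exists_of_tight (ρ : ℕ → Measure ℝ) [∀ i, IsProbabilityMeasure (ρ i)]
    (ht : IsTightMeasureSet (Set.range ρ)) :
    ∃ ν : Measure ℝ, IsProbabilityMeasure ν ∧ ∀ t, Filter.Tendsto (fun n => charFun (ρ n) t)
      (Filter.hyperfilter ℕ) (nhds (charFun ν t)) := by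
  let P : ℕ → ProbabilityMeasure ℝ := fun n => ⟨ρ n, inferInstance⟩
  have hc : IsCompact (closure (Set.range P)) := by
    apply isCompact_closure_of_isTightMeasureSet
    convert! ht
    ext m
    constructor
    · rintro ⟨_, ⟨n, rfl⟩, rfl⟩
      exact ⟨n, rfl⟩
    · rintro ⟨n, rfl⟩
      exact ⟨P n, ⟨n, rfl⟩, rfl⟩
  obtain ⟨x, -, hx⟩ := hc.ultrafilter_le_nhds ((Filter.hyperfilter ℕ : Ultrafilter ℕ).map P) (by
    simp only [Ultrafilter.coe_map, Filter.le_principal_iff, Filter.mem_map]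
    exact Filter.Eventually.of_forall fun n => subset_closure ⟨n, rfl⟩)
  have hx' : Filter.Tendsto P (Filter.hyperfilter ℕ) (nhds x) := hx
  refine ⟨x, inferInstance, fun t => ?_⟩
  rw [ProbabilityMeasure.tendsto_iff_forall_integral_rclike_tendsto ℂ] at hx'
  simp_rw [charFun_eq_integral_innerProbChar]
  exact hx' (BoundedContinuousFunction.innerProbChar t)

theorem exists_of_tendsto (ρ : ℕ → Measure ℝ) [∀ i, IsProbabilityMeasure (ρ i)] (f : ℝ → ℂ)
    (hf : Continuous f)
    (h : ∀ t, Filter.Tendsto (fun n => charFun (ρ n) t) Filter.atTop (nhds (f t))) :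
    ∃ ν : Measure ℝ, IsProbabilityMeasure ν ∧ ∀ t, charFun ν t = f t := by
  obtain ⟨ν, hν, hl⟩ := exists_of_tight ρ (isTightMeasureSet_of_tendsto_charFun hf.continuousAt h)
  refine ⟨ν, hν, fun t => tendsto_nhds_unique (hl t) ((h t).mono_left ?_)⟩
  rw [← Nat.cofinite_eq_atTop]
  exact Filter.hyperfilter_le_cofinite

open Complex in
theorem integral_exp_kernel (t y : ℝ) (hy : y ≠ 0) :
    ∫ s in (0 : ℝ)..t, I * exp (s * y * I) = (exp (t * y * I) - 1) / y := by
  have h : (y : ℂ) * I ≠ 0 := by simp [hy]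
  have h2 := integral_exp_mul_complex (a := 0) (b := t) h
  rw [intervalIntegral.integral_const_mul]
  have : ∀ s : ℝ, exp (s * y * I) = exp (y * I * s) := fun s => by ring_nf
  simp_rw [this, h2]
  have hy' : (y : ℂ) ≠ 0 := by exact_mod_cast hy
  have hI := I_ne_zero
  field_simp
  simp

open Complex in
theorem exists_factor (ν : Measure ℝ) [IsProbabilityMeasure ν] (hν : ν {x | x < 0} = 0)
    (δ : ℝ) (hδ : 0 < δ) : ∃ κ : Measure ℝ, IsProbabilityMeasure κ ∧ ∀ t : ℝ,
      charFun κ t = 1 + δ * (I * ∫ s in (0 : ℝ)..t, exp (s * δ * I) * charFun ν s) := by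
  have hae : ∀ᵐ x ∂ν, 0 ≤ x := by
    rw [ae_iff]; simpa using hν
  set q : ℝ → ℝ := fun x => δ / (|x| + δ) with hq
  have hqc : Continuous q := by
    refine continuous_const.div (by fun_prop) fun x => ?_
    positivity
  have hq0 : ∀ x, 0 ≤ q x := fun x => by positivity
  have hq1 : ∀ x, q x ≤ 1 := fun x => by
    simp only [hq]
    rw [div_le_one (by positivity)]
    linarith [abs_nonneg x]
  have hqm := hqc.measurable
  have hqi : Integrable q ν := Integrable.of_bound hqm.aestronglyMeasurable 1
    (Filter.Eventually.of_forall fun x => by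
      rw [Real.norm_eq_abs, abs_of_nonneg (hq0 x)]; exact hq1 x)
  set W := ν.withDensity fun x => ENNReal.ofReal (q x) with hW
  set c := ∫ x, q x ∂ν with hc
  have hc1 : c ≤ 1 := by
    have := integral_mono hqi (integrable_const (1 : ℝ)) hq1
    simpa using this
  have hc0 : 0 ≤ c := integral_nonneg hq0
  have hWu : W Set.univ = ENNReal.ofReal c := by
    rw [hW, withDensity_apply _ MeasurableSet.univ, Measure.restrict_univ,
      ofReal_integral_eq_lintegral_ofReal hqi (Filter.Eventually.of_forall hq0)]
  have : IsFiniteMeasure W := ⟨by rw [hWu]; exact ENNReal.ofReal_lt_top⟩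
  refine ⟨W.map (· + δ) + ENNReal.ofReal (1 - c) • Measure.dirac 0, ⟨?_⟩, fun t => ?_⟩
  · rw [Measure.add_apply, Measure.map_apply (by fun_prop) MeasurableSet.univ, Set.preimage_univ,
      hWu, Measure.smul_apply, measure_univ, smul_eq_mul, mul_one,
      ← ENNReal.ofReal_add hc0 (by linarith)]
    simp
  · have hb : ∀ (m : Measure ℝ) [IsFiniteMeasure m] (u : ℝ),
        Integrable (fun x : ℝ => exp (t * (x + u : ℝ) * I)) m := by
      intro m _ u
      refine Integrable.of_bound (by fun_prop) 1 (Filter.Eventually.of_forall fun x => ?_)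
      rw [← ofReal_mul, norm_exp_ofReal_mul_I]
    have hb0 : ∀ (m : Measure ℝ) [IsFiniteMeasure m],
        Integrable (fun x : ℝ => exp (t * x * I)) m := by
      intro m _
      simpa using hb m 0
    have hqe : Integrable (fun x => (q x : ℂ) * exp (t * (x + δ : ℝ) * I)) ν := by
      refine Integrable.of_bound (by fun_prop) 1 (Filter.Eventually.of_forall fun x => ?_)
      rw [norm_mul, ← ofReal_mul, norm_exp_ofReal_mul_I, norm_real, Real.norm_eq_abs,
        abs_of_nonneg (hq0 x), mul_one]
      exact hq1 x
    rw [charFun_apply_real, integral_add_measure (hb0 _)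
      ((hb0 (Measure.dirac 0)).smul_measure ENNReal.ofReal_ne_top),
      integral_map (by fun_prop) (by fun_prop), integral_smul_measure, integral_dirac,
      ENNReal.toReal_ofReal (by linarith), hW,
      integral_withDensity_eq_integral_toReal_smul (by fun_prop) (by simp)]
    have e1 : ∀ x : ℝ, (ENNReal.ofReal (q x)).toReal • exp (t * (x + δ : ℝ) * I)
        = (q x : ℂ) * exp (t * (x + δ : ℝ) * I) := fun x => by
      rw [ENNReal.toReal_ofReal (hq0 x), real_smul]
    simp_rw [e1]
    have e2 : (∫ x, (q x : ℂ) * exp (t * (x + δ : ℝ) * I) ∂ν) - c =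
        ∫ x, (q x : ℂ) * (exp (t * (x + δ : ℝ) * I) - 1) ∂ν := by
      simp_rw [mul_sub, mul_one]
      have hqi' : Integrable (fun x => (q x : ℂ)) ν := hqi.ofReal
      rw [integral_sub hqe hqi', integral_complex_ofReal]
    have e3 : ∫ x, (q x : ℂ) * (exp (t * (x + δ : ℝ) * I) - 1) ∂ν =
        ∫ x, ((δ : ℂ) * ∫ s in (0 : ℝ)..t, I * exp (s * (x + δ : ℝ) * I)) ∂ν := by
      apply integral_congr_ae
      filter_upwards [hae] with x hx
      have hne : x + δ ≠ 0 := by positivity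
      rw [integral_exp_kernel t _ hne, hq]
      simp only [abs_of_nonneg hx]
      rw [ofReal_div]
      ring
    have e4 : ∫ x, (∫ s in (0 : ℝ)..t, I * exp (s * (x + δ : ℝ) * I)) ∂ν =
        I * ∫ s in (0 : ℝ)..t, exp (s * δ * I) * charFun ν s := by
      rw [← intervalIntegral_integral_swap, ← intervalIntegral.integral_const_mul]
      · congr 1
        ext s
        rw [charFun_apply_real, integral_const_mul, ← integral_const_mul (exp _)]
        congr 2
        ext x
        rw [← Complex.exp_add]
        push_cast
        ring_nf
      · have : IsFiniteMeasure (volume.restrict (Set.uIoc 0 t)) :=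
          ⟨by simp [Set.uIoc]⟩
        refine Integrable.of_bound (by fun_prop) 1 (Filter.Eventually.of_forall fun x => ?_)
        simp only [Function.uncurry]
        rw [norm_mul, norm_I, one_mul, ← ofReal_mul, norm_exp_ofReal_mul_I]
    rw [integral_const_mul, e4] at e3
    rw [← e3, ← e2]
    simp
    ring

open Complex Filter in
theorem exists_root (ν : Measure ℝ) [IsProbabilityMeasure ν] (hν : ν {x | x < 0} = 0)
    (b : ℝ) (hb : 0 < b) : ∃ κ : Measure ℝ, IsProbabilityMeasure κ ∧ ∀ t : ℝ,
      charFun κ t = exp (b * (I * ∫ s in (0 : ℝ)..t, charFun ν s)) := by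
  have hδ : ∀ m : ℕ, 0 < b / (m + 1 : ℕ) := fun m => by positivity
  choose κ hκ hk using fun m : ℕ => exists_factor ν hν (b / (m + 1 : ℕ)) (hδ m)
  have hcont : Continuous fun t : ℝ => exp (b * (I * ∫ s in (0 : ℝ)..t, charFun ν s)) := by
    have : Continuous fun t : ℝ => ∫ s in (0 : ℝ)..t, charFun ν s :=
      intervalIntegral.continuous_primitive
        (fun a b => (continuous_charFun (μ := ν)).intervalIntegrable a b) 0
    fun_prop
  refine exists_of_tendsto (fun m => convPow (κ m) (m + 1)) _ hcont fun t => ?_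
  simp_rw [charFun_convPow, hk]
  set g : ℕ → ℂ := fun m => ((b / m : ℝ) : ℂ) *
    (I * ∫ s in (0 : ℝ)..t, exp (s * (b / m : ℝ) * I) * charFun ν s) with hg
  suffices h : Tendsto (fun m : ℕ => (1 + g m) ^ m) atTop
      (nhds (exp (b * (I * ∫ s in (0 : ℝ)..t, charFun ν s)))) from
    h.comp (tendsto_add_atTop_nat 1)
  apply tendsto_one_add_pow_exp_of_tendsto
  have hlim : Tendsto (fun m : ℕ => ∫ s in (0 : ℝ)..t, exp (s * (b / m : ℝ) * I) * charFun ν s)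
      atTop (nhds (∫ s in (0 : ℝ)..t, charFun ν s)) := by
    apply intervalIntegral.tendsto_integral_filter_of_dominated_convergence (fun _ => (1 : ℝ))
    · refine Eventually.of_forall fun m => ?_
      have := continuous_charFun (μ := ν)
      exact Continuous.aestronglyMeasurable (by fun_prop)
    · refine Eventually.of_forall fun m => Eventually.of_forall fun s _ => ?_
      rw [norm_mul, ← ofReal_mul, norm_exp_ofReal_mul_I, one_mul]
      exact norm_charFun_le_one s
    · exact intervalIntegrable_const
    · refine Eventually.of_forall fun s _ => ?_
      have h0 : Tendsto (fun m : ℕ => b / (m : ℝ)) atTop (nhds 0) :=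
        tendsto_const_div_atTop_nhds_zero_nat b
      have hc : Continuous fun u : ℝ => exp (s * u * I) * charFun ν s := by fun_prop
      have := (hc.tendsto 0).comp h0
      simpa [Function.comp_def] using this
  refine ((hlim.const_mul I).const_mul (b : ℂ)).congr' ?_
  filter_upwards [eventually_ne_atTop 0] with m hm
  have : (m : ℂ) ≠ 0 := by exact_mod_cast hm
  simp only [hg]
  rw [ofReal_div, ofReal_natCast]
  field_simp

theorem backward (μ ν : Measure ℝ) [IsProbabilityMeasure μ] [IsProbabilityMeasure ν]
    (hpos : μ {x | x < 0} = 0) (hInt : Integrable (fun x => x) μ)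
    (hmean : 0 < ∫ x, x ∂μ) (h : sizeBiasedLaw μ = μ.conv ν) (n : ℕ) (hn : 1 ≤ n) :
    ∃ κ : Measure ℝ, IsProbabilityMeasure κ ∧ μ = convPow κ n := by
  have hn' : (0 : ℝ) < n := by exact_mod_cast hn
  obtain ⟨κ, hκ, hk⟩ := exists_root ν (nu_nonneg μ ν hpos h) ((∫ x, x ∂μ) / n) (by positivity)
  refine ⟨κ, hκ, Measure.ext_of_charFun ?_⟩
  ext t
  rw [charFun_convPow, hk, charFun_exp μ ν hpos hInt hmean h, ← Complex.exp_nat_mul]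
  congr 1
  have : (n : ℂ) ≠ 0 := by exact_mod_cast hn'.ne'
  rw [Complex.ofReal_div, Complex.ofReal_natCast]
  field_simp

theorem uniq (μ ν ν' : Measure ℝ) [IsProbabilityMeasure μ] [IsProbabilityMeasure ν]
    [IsProbabilityMeasure ν']
    (hpos : μ {x | x < 0} = 0) (hInt : Integrable (fun x => x) μ)
    (hmean : 0 < ∫ x, x ∂μ) (h : sizeBiasedLaw μ = μ.conv ν) (h' : sizeBiasedLaw μ = μ.conv ν') :
    ν' = ν := by
  apply Measure.ext_of_charFun
  ext t
  have h1 : charFun μ t * charFun ν' t = charFun μ t * charFun ν t := by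
    rw [← charFun_conv, ← charFun_conv, ← h, ← h']
  have h2 : charFun μ t ≠ 0 := by
    rw [charFun_exp μ ν hpos hInt hmean h]
    exact Complex.exp_ne_zero _
  exact mul_left_cancel₀ h2 h1

theorem integrable_of_conv (α ν : Measure ℝ) [IsProbabilityMeasure α] [IsProbabilityMeasure ν]
    (hα : α {x | 0 ≤ x} = 1) (hν : ν {x | x < 0} = 0)
    (h : Integrable (fun x => x) (α.conv ν)) : Integrable (fun x => x) ν := by
  have hα' : ∀ᵐ x ∂α, 0 ≤ x := by
    have : α ({x | 0 ≤ x}ᶜ) = 0 := (prob_compl_eq_zero_iff measurableSet_Ici).2 hα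
    exact this
  have hν' : ∀ᵐ x ∂ν, 0 ≤ x := by
    rw [ae_iff]; simpa using hν
  refine ⟨by fun_prop, ?_⟩
  have h2 := h.2
  rw [HasFiniteIntegral] at h2 ⊢
  rw [Measure.lintegral_conv (by fun_prop)] at h2
  refine lt_of_le_of_lt ?_ h2
  calc ∫⁻ y, ‖y‖ₑ ∂ν = ∫⁻ _x, ∫⁻ y, ‖y‖ₑ ∂ν ∂α := by simp
    _ ≤ _ := by
      apply lintegral_mono_ae
      filter_upwards [hα'] with x hx
      apply lintegral_mono_ae
      filter_upwards [hν'] with y hy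
      rw [Real.enorm_of_nonneg hy, Real.enorm_of_nonneg (add_nonneg hx hy)]
      exact ENNReal.ofReal_le_ofReal (by linarith)

theorem root_props (μ ν : Measure ℝ) [IsProbabilityMeasure μ] [IsProbabilityMeasure ν]
    (hpos : μ {x | x < 0} = 0) (hInt : Integrable (fun x => x) μ)
    (hmean : 0 < ∫ x, x ∂μ) (n : ℕ) (h : μ = convPow ν (n + 1)) :
    ν {x | x < 0} = 0 ∧ Integrable (fun x => x) ν ∧
      ∫ x, x ∂μ = (n + 1) * ∫ x, x ∂ν ∧
      sizeBiasedLaw μ = (convPow ν n).conv (sizeBiasedLaw ν) := by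
  have h0 : ν {x | x < 0} = 0 := by
    have := convPow_neg ν n
    rw [← h, hpos] at this
    exact eq_zero_of_pow_eq_zero (le_antisymm this zero_le)
  have hi : Integrable (fun x => x) ν := by
    refine integrable_of_conv (convPow ν n) ν (convPow_nonneg ν h0 n) h0 ?_
    rw [h] at hInt
    exact hInt
  have hν' : ∀ᵐ x ∂ν, 0 ≤ x := by
    rw [ae_iff]; simpa using h0
  -- the mean of `ν` is positive, since otherwise `ν = δ₀`
  have hm : 0 < ∫ x, x ∂ν := by
    refine lt_of_le_of_ne (integral_nonneg_of_ae hν') fun h1 => ?_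
    have h2 := (integral_eq_zero_iff_of_nonneg_ae hν' hi).1 h1.symm
    have h3 : ∀ t, charFun ν t = 1 := by
      intro t
      rw [charFun_apply_real]
      have : ∫ x : ℝ, Complex.exp (t * x * Complex.I) ∂ν = ∫ _x : ℝ, (1 : ℂ) ∂ν := by
        apply integral_congr_ae
        filter_upwards [h2] with x hx
        simp at hx
        simp [hx]
      rw [this]; simp
    have h4 : charFun μ = fun _ => 1 := by
      ext t
      rw [h, charFun_convPow, h3, one_pow]
    have h5 := hasDeriv_charFun μ hpos hInt hmean 0
    rw [h4] at h5
    have h6 := h5.unique (hasDerivAt_const (0 : ℝ) (1 : ℂ))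
    have := sb_prob μ hpos hInt hmean
    simp at h6
    linarith
  have := sb_prob μ hpos hInt hmean
  have := sb_prob ν h0 hi hm
  have hd : ∀ t, ((∫ x, x ∂μ : ℝ) : ℂ) * charFun (sizeBiasedLaw μ) t
      = (n + 1) * charFun ν t ^ n * ((∫ x, x ∂ν : ℝ) * charFun (sizeBiasedLaw ν) t) := by
    intro t
    have h5 := hasDeriv_charFun μ hpos hInt hmean t
    have h6 := (hasDeriv_charFun ν h0 hi hm t).pow (n + 1)
    have h7 : charFun μ = charFun ν ^ (n + 1) := by
      ext t
      rw [h, charFun_convPow]; rfl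
    rw [h7] at h5
    have h8 := h5.unique h6
    apply mul_left_cancel₀ Complex.I_ne_zero
    rw [h8]
    push_cast
    ring
  have hme : ∫ x, x ∂μ = (n + 1) * ∫ x, x ∂ν := by
    have := hd 0
    simp at this
    exact_mod_cast this
  refine ⟨h0, hi, hme, Measure.ext_of_charFun ?_⟩
  ext t
  rw [charFun_conv, charFun_convPow]
  have h9 := hd t
  have : ((∫ x, x ∂μ : ℝ) : ℂ) ≠ 0 := by exact_mod_cast hmean.ne'
  apply mul_left_cancel₀ this
  rw [h9, hme]
  push_cast
  ring

open Filter in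
theorem forward_s19 (μ : Measure ℝ) [IsProbabilityMeasure μ]
    (hpos : μ {x | x < 0} = 0) (hInt : Integrable (fun x => x) μ)
    (hmean : 0 < ∫ x, x ∂μ)
    (h : ∀ n : ℕ, 1 ≤ n → ∃ ν : Measure ℝ, IsProbabilityMeasure ν ∧ μ = convPow ν n) :
    ∃ ν : Measure ℝ, IsProbabilityMeasure ν ∧ sizeBiasedLaw μ = μ.conv ν := by
  have := sb_prob μ hpos hInt hmean
  choose ν hν hconv using fun n : ℕ => h (n + 1) (by omega)
  have hp := fun n => root_props μ (ν n) hpos hInt hmean n (hconv n)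
  have hm : ∀ n, ∫ x, x ∂(ν n) = (∫ x, x ∂μ) / (n + 1) := fun n => by
    rw [(hp n).2.2.1]
    field_simp
  have hmp : ∀ n, 0 < ∫ x, x ∂(ν n) := fun n => by rw [hm]; positivity
  have : ∀ n, IsProbabilityMeasure (sizeBiasedLaw (ν n)) :=
    fun n => sb_prob (ν n) (hp n).1 (hp n).2.1 (hmp n)
  have htight : IsTightMeasureSet (Set.range fun n => sizeBiasedLaw (ν n)) := by
    have h1 : IsTightMeasureSet {sizeBiasedLaw μ} := isTightMeasureSet_singleton
    rw [isTightMeasureSet_iff_exists_isCompact_measure_compl_le] at h1 ⊢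
    intro ε hε
    obtain ⟨K, hK, hKε⟩ := h1 ε hε
    have hKε := hKε _ rfl
    obtain ⟨R, hR⟩ := hK.isBounded.bddAbove
    refine ⟨Set.Icc 0 R, isCompact_Icc, ?_⟩
    rintro _ ⟨n, rfl⟩
    have hz : sizeBiasedLaw (ν n) {x | x < 0} = 0 :=
      withDensity_absolutelyContinuous _ _ (hp n).1
    have hge := conv_ge (convPow (ν n) n) (sizeBiasedLaw (ν n)) (A := {x | 0 ≤ x})
      (B := {x | R < x}) (C := {x | R < x}) measurableSet_Ioi (by
        intro x hx y hy
        simp only [Set.mem_ofPred_eq] at *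
        linarith)
    rw [convPow_nonneg _ (hp n).1, one_mul, ← (hp n).2.2.2] at hge
    calc sizeBiasedLaw (ν n) (Set.Icc 0 R)ᶜ
        ≤ sizeBiasedLaw (ν n) ({x | x < 0} ∪ {x | R < x}) := by
          apply measure_mono
          intro x hx
          by_contra hcon
          simp only [Set.mem_union, Set.mem_ofPred_eq, not_or, not_lt] at hcon
          exact hx ⟨hcon.1, hcon.2⟩
      _ ≤ sizeBiasedLaw (ν n) {x | x < 0} + sizeBiasedLaw (ν n) {x | R < x} := measure_union_le _ _
      _ ≤ sizeBiasedLaw μ {x | R < x} := by rw [hz, zero_add]; exact hge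
      _ ≤ sizeBiasedLaw μ Kᶜ := by
          apply measure_mono
          intro x hx hxK
          exact absurd (hR hxK) (not_le.2 hx)
      _ ≤ ε := hKε
  obtain ⟨Y, hY, hYt⟩ := exists_of_tight _ htight
  refine ⟨Y, hY, Measure.ext_of_charFun ?_⟩
  ext t
  rw [charFun_conv]
  -- `φ_n → 1`
  have h1 : Tendsto (fun n => charFun (ν n) t) atTop (nhds 1) := by
    rw [tendsto_iff_norm_sub_tendsto_zero]
    have hlim : Tendsto (fun n : ℕ => |t| * ((∫ x, x ∂μ) / (n + 1))) atTop (nhds 0) := by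
      have := (tendsto_const_div_atTop_nhds_zero_nat (∫ x, x ∂μ)).comp (tendsto_add_atTop_nat 1)
      simpa using this.const_mul |t|
    refine squeeze_zero (fun _ => norm_nonneg _) (fun n => ?_) hlim
    have hn0 : ∀ᵐ x ∂(ν n), 0 ≤ x := by
      rw [ae_iff]; simpa using (hp n).1
    have he : Integrable (fun x : ℝ => Complex.exp (t * x * Complex.I)) (ν n) := by
      refine Integrable.of_bound (by fun_prop) 1 (Eventually.of_forall fun x => ?_)
      rw [← Complex.ofReal_mul, Complex.norm_exp_ofReal_mul_I]
    have : charFun (ν n) t - 1 = ∫ x : ℝ, (Complex.exp (t * x * Complex.I) - 1) ∂(ν n) := by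
      rw [integral_sub he (integrable_const _), charFun_apply_real]; simp
    rw [this, ← hm n, ← integral_const_mul]
    apply norm_integral_le_of_norm_le ((hp n).2.1.const_mul _)
    filter_upwards [hn0] with x hx
    have := Real.norm_exp_I_mul_ofReal_sub_one_le (x := t * x)
    rw [norm_mul, Real.norm_eq_abs, Real.norm_eq_abs, abs_of_nonneg hx] at this
    rw [Complex.ofReal_mul, mul_comm Complex.I] at this
    exact this
  have hle : ((hyperfilter ℕ : Ultrafilter ℕ) : Filter ℕ) ≤ atTop := by
    rw [← Nat.cofinite_eq_atTop]
    exact hyperfilter_le_cofinite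
  have hL := (h1.mono_left hle).mul_const (charFun (sizeBiasedLaw μ) t)
  have hR := (hYt t).const_mul (charFun μ t)
  rw [one_mul] at hL
  refine tendsto_nhds_unique hL (hR.congr fun n => ?_)
  rw [(hp n).2.2.2, charFun_conv, charFun_convPow]
  have : charFun μ t = charFun (ν n) t ^ (n + 1) := by
    rw [← charFun_convPow, ← hconv n]
  rw [this]
  ring

/-- Steutel's characterization (for nonnegative `X` with finite positive
mean): `X` is infinitely divisible — for each `n ≥ 1` the law of `X` is the
`n`-fold convolution of some probability law, i.e. `X =ᵈ X₁⁽ⁿ⁾ + ⋯ + Xₙ⁽ⁿ⁾`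
with i.i.d. summands — iff there is a random variable `Y`, independent of
`X`, with `X* =ᵈ X + Y` (i.e. the size-biased law of `X` is the convolution
of the law of `X` with some probability law `ν`).  In either case the law of
`Y` is unique and `P(Y ≥ 0) = 1`. -/
theorem stmt19 (μ : Measure ℝ) [IsProbabilityMeasure μ]
    (hpos : μ {x | x < 0} = 0)
    (hInt : Integrable (fun x => x) μ)
    (hmean : 0 < ∫ x, x ∂μ) :
    ((∀ n : ℕ, 1 ≤ n → ∃ ν : Measure ℝ, IsProbabilityMeasure ν ∧ μ = convPow ν n) ↔
      (∃ ν : Measure ℝ, IsProbabilityMeasure ν ∧ sizeBiasedLaw μ = μ.conv ν)) ∧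
    ((∃ ν : Measure ℝ, IsProbabilityMeasure ν ∧ sizeBiasedLaw μ = μ.conv ν) →
      ((∃! ν : Measure ℝ, IsProbabilityMeasure ν ∧ sizeBiasedLaw μ = μ.conv ν) ∧
        (∀ ν : Measure ℝ, IsProbabilityMeasure ν → sizeBiasedLaw μ = μ.conv ν →
          ν {x | x < 0} = 0))) := by
  refine ⟨⟨forward_s19 μ hpos hInt hmean, ?_⟩, ?_⟩
  · rintro ⟨ν, hν, h⟩ n hn
    exact backward μ ν hpos hInt hmean h n hn
  · rintro ⟨ν, hν, h⟩
    refine ⟨⟨ν, ⟨hν, h⟩, ?_⟩, ?_⟩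
    · rintro ν' ⟨hν', h'⟩
      exact uniq μ ν ν' hpos hInt hmean h h'
    · intro ν' hν' h'
      exact nu_nonneg μ ν' hpos h'
end
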